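/- arXiv:1110.5888 — 2 statements merged into one kernel-verified Lean document; each statement's English description precedes it below -/
import Mathlib

section
/- Let n ≥ 2, k ≥ 3, and 0 < ε ≤ 1. If f : S_k^n → [k] is an SCF with D(f, NONMANIP-bar) ≥ ε, then P(σ ∈ M_4(f)) ≥ ε^5 / (10^9 · n^7 · k^46), where σ is uniform on S_k^n. -/
open Finset

/-- `a` is ranked above `b` in the ranking `τ` (a ranking maps positions to
alternatives; earlier positions are better). -/
def Above {k : ℕ} (τ : Equiv.Perm (Fin k)) (a b : Fin k) : Prop :=
  τ.symm a < τ.symm b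

/-- Uniform probability of an event over a finite type. -/
noncomputable def prob {Ω : Type*} [Fintype Ω] (p : Ω → Prop) : ℝ := by
  classical exact ((Finset.univ.filter p).card : ℝ) / (Fintype.card Ω : ℝ)

/-- Number of elements satisfying an event, as a real number. -/
noncomputable def count {Ω : Type*} [Fintype Ω] (p : Ω → Prop) : ℝ := by
  classical exact ((Finset.univ.filter p).card : ℝ)

/-- A ranking profile for `n` voters and `k` alternatives. -/
abbrev Profile (n k : ℕ) := Fin n → Equiv.Perm (Fin k)

/-- `(σ, σ')` is a manipulation pair for `f` at coordinate `i`: they differ exactly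
in coordinate `i` and voter `i` truly prefers `f σ'` to `f σ`. -/
def IsManipPairAt {n k : ℕ} (f : Profile n k → Fin k) (σ σ' : Profile n k) (i : Fin n) : Prop :=
  σ i ≠ σ' i ∧ (∀ j, j ≠ i → σ j = σ' j) ∧ Above (σ i) (f σ') (f σ)

/-- `σ` is a manipulation point of `f`, i.e. `σ ∈ M(f)`. -/
def IsManipPoint {n k : ℕ} (f : Profile n k → Fin k) (σ : Profile n k) : Prop :=
  ∃ σ' i, IsManipPairAt f σ σ' i

/-- `τ` and `τ'` agree outside a block of at most `r` consecutive positions. -/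
def AgreeOutsideBlock {k : ℕ} (r : ℕ) (τ τ' : Equiv.Perm (Fin k)) : Prop :=
  ∃ l : ℕ, ∀ p : Fin k, ((p : ℕ) < l ∨ l + r ≤ (p : ℕ)) → τ p = τ' p

/-- `σ` is an `r`-manipulation point of `f`, i.e. `σ ∈ M_r(f)`. -/
def IsManipPointR {n k : ℕ} (r : ℕ) (f : Profile n k → Fin k) (σ : Profile n k) : Prop :=
  ∃ σ' i, IsManipPairAt f σ σ' i ∧ AgreeOutsideBlock r (σ i) (σ' i)

/-- `f` always elects the top alternative of `H` according to voter `i`. -/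
def IsTopOn {n k : ℕ} (f : Profile n k → Fin k) (i : Fin n) (H : Finset (Fin k)) : Prop :=
  ∀ σ, f σ ∈ H ∧ ∀ b ∈ H, b ≠ f σ → Above (σ i) (f σ) b

/-- `f` takes exactly two values. -/
def TakesExactlyTwoValues {n k : ℕ} (f : Profile n k → Fin k) : Prop :=
  ∃ a b : Fin k, a ≠ b ∧ (∀ σ, f σ = a ∨ f σ = b) ∧ (∃ σ, f σ = a) ∧ (∃ σ, f σ = b)

/-- `f` is monotone: whenever `σ, σ'` differ in exactly one coordinate `i` and
`f σ ≠ f σ'`, voter `i` ranks `f σ'` above `f σ` in `σ' i`. -/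
def IsMonotone {n k : ℕ} (f : Profile n k → Fin k) : Prop :=
  ∀ (σ σ' : Profile n k) (i : Fin n),
    σ i ≠ σ' i → (∀ j, j ≠ i → σ j = σ' j) → f σ ≠ f σ' → Above (σ' i) (f σ') (f σ)

/-- The family `NONMANIP(n,k)` of nonmanipulable social choice functions. -/
def InNonManip {n k : ℕ} (f : Profile n k → Fin k) : Prop :=
  (∃ (i : Fin n) (H : Finset (Fin k)), H.Nonempty ∧ IsTopOn f i H) ∨
  (TakesExactlyTwoValues f ∧ IsMonotone f)

/-- The family `NONMANIP-bar`: functions depending on one coordinate only,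
or taking at most two values. -/
def InNonManipBar {n k : ℕ} (f : Profile n k → Fin k) : Prop :=
  (∃ i : Fin n, ∀ σ σ' : Profile n k, σ i = σ' i → f σ = f σ') ∨
  (∃ a b : Fin k, ∀ σ, f σ = a ∨ f σ = b)

/-- `σ` lies in the fiber `F(z^{a,b})`: `z i = true` iff voter `i` prefers `a` to `b`. -/
def InFiber {n k : ℕ} (a b : Fin k) (z : Fin n → Bool) (σ : Profile n k) : Prop :=
  ∀ i, Above (σ i) a b ↔ z i = true

/-- `σ` is on the boundary `B_i^{a,b}(f)`: `f σ = a` and some `σ'` differing from `σ`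
only in coordinate `i` has `f σ' = b`. -/
def OnBoundaryB {n k : ℕ} (f : Profile n k → Fin k) (i : Fin n) (a b : Fin k)
    (σ : Profile n k) : Prop :=
  f σ = a ∧ ∃ σ' : Profile n k, σ i ≠ σ' i ∧ (∀ j, j ≠ i → σ j = σ' j) ∧ f σ' = b

/-- `σ ∈ B_i(z^{a,b})`. -/
def InBFiber {n k : ℕ} (f : Profile n k → Fin k) (i : Fin n) (a b : Fin k)
    (z : Fin n → Bool) (σ : Profile n k) : Prop :=
  InFiber a b z σ ∧ OnBoundaryB f i a b σ

/-- The fiber `B_i(z^{a,b})` is large (for the parameter `ε`):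
`P(σ ∈ B_i(z^{a,b}) | σ ∈ F(z^{a,b})) ≥ 1 - ε^3/(4 n^3 k^9)`. -/
def IsLargeFiber {n k : ℕ} (f : Profile n k → Fin k) (ε : ℝ) (i : Fin n) (a b : Fin k)
    (z : Fin n → Bool) : Prop :=
  1 - ε ^ 3 / (4 * (n : ℝ) ^ 3 * (k : ℝ) ^ 9) ≤
    prob (fun σ : Profile n k => InBFiber f i a b z σ) /
      prob (fun σ : Profile n k => InFiber a b z σ)

/-- `σ ∈ Lg(B_i^{a,b})`, the union of the large fibers. -/
def InLg {n k : ℕ} (f : Profile n k → Fin k) (ε : ℝ) (i : Fin n) (a b : Fin k)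
    (σ : Profile n k) : Prop :=
  ∃ z, IsLargeFiber f ε i a b z ∧ InBFiber f i a b z σ

/-- `σ ∈ Sm(B_i^{a,b})`, the union of the small fibers. -/
def InSm {n k : ℕ} (f : Profile n k → Fin k) (ε : ℝ) (i : Fin n) (a b : Fin k)
    (σ : Profile n k) : Prop :=
  ∃ z, ¬ IsLargeFiber f ε i a b z ∧ InBFiber f i a b z σ

/-- Two profiles differ in exactly one coordinate. -/
def AdjOneCoord {n k : ℕ} (σ π : Profile n k) : Prop :=
  ∃ i, σ i ≠ π i ∧ ∀ j, j ≠ i → σ j = π j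

/-- `σ` belongs to the vertex boundary `∂(B_i(z^{a,b}))` of `B_i(z^{a,b})` inside the
fiber `F(z^{a,b})`. -/
def InFiberBdry {n k : ℕ} (f : Profile n k → Fin k) (i : Fin n) (a b : Fin k)
    (z : Fin n → Bool) (σ : Profile n k) : Prop :=
  InBFiber f i a b z σ ∧
    ∃ π, AdjOneCoord σ π ∧ InFiber a b z π ∧ ¬ InBFiber f i a b z π

/-- `σ₋ᵢ ∈ D_i(a,b)`: fixing all coordinates except `i` according to `σ`, the induced
one-voter SCF equals `top_H` for some `H ⊇ {a,b}` with `|H| ≥ 3`. -/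
def InD1 {n k : ℕ} (f : Profile n k → Fin k) (i : Fin n) (a b : Fin k)
    (σ : Profile n k) : Prop :=
  ∃ H : Finset (Fin k), a ∈ H ∧ b ∈ H ∧ 3 ≤ H.card ∧
    ∀ τ : Equiv.Perm (Fin k),
      f (Function.update σ i τ) ∈ H ∧
        ∀ c ∈ H, c ≠ f (Function.update σ i τ) → Above τ (f (Function.update σ i τ)) c



/-! ## Basic facts on uniform probabilities -/

namespace QGS

section ProbBasics

/-- Uniform average. -/
noncomputable def ex {Ω : Type*} [Fintype Ω] (g : Ω → ℝ) : ℝ := (∑ ω, g ω) / (Fintype.card Ω : ℝ)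

variable {Ω Ω' Ω'' : Type*} [Fintype Ω] [Fintype Ω'] [Fintype Ω'']

open Classical in
lemma prob_eq (p : Ω → Prop) : prob p = ex (fun ω => if p ω then (1 : ℝ) else 0) := by
  unfold prob ex
  simp

lemma ex_mono {g h : Ω → ℝ} (H : ∀ ω, g ω ≤ h ω) : ex g ≤ ex h := by
  unfold ex
  gcongr with ω
  exact H ω

lemma ex_add (g h : Ω → ℝ) : ex (fun ω => g ω + h ω) = ex g + ex h := by
  unfold ex
  rw [Finset.sum_add_distrib, add_div]

lemma ex_const [Nonempty Ω] (c : ℝ) : ex (fun _ : Ω => c) = c := by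
  unfold ex
  simp

lemma ex_nonneg {g : Ω → ℝ} (H : ∀ ω, 0 ≤ g ω) : 0 ≤ ex g := by
  unfold ex
  have := Finset.sum_nonneg (s := univ) (fun ω _ => H ω)
  positivity

lemma ex_mul_left (c : ℝ) (g : Ω → ℝ) : ex (fun ω => c * g ω) = c * ex g := by
  unfold ex
  rw [← Finset.mul_sum, mul_div_assoc]

lemma ex_equiv (e : Ω ≃ Ω') (g : Ω' → ℝ) : ex (fun ω => g (e ω)) = ex g := by
  unfold ex
  rw [Equiv.sum_comp e g, Fintype.card_congr e]

lemma ex_prod (g : Ω × Ω' → ℝ) : ex g = ex (fun ω => ex (fun ω' => g (ω, ω'))) := by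
  unfold ex
  rw [Fintype.sum_prod_type, Fintype.card_prod, ← Finset.sum_div, div_div]
  push_cast
  rw [mul_comm]

lemma prob_mono {p q : Ω → Prop} (H : ∀ ω, p ω → q ω) : prob p ≤ prob q := by
  classical
  rw [prob_eq, prob_eq]
  apply ex_mono
  intro ω
  have := H ω
  split_ifs <;> first | linarith | tauto

lemma prob_congr {p q : Ω → Prop} (H : ∀ ω, p ω ↔ q ω) : prob p = prob q := by
  have : p = q := funext fun ω => propext (H ω)
  rw [this]

lemma prob_nonneg (p : Ω → Prop) : 0 ≤ prob p := by
  classical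
  rw [prob_eq]
  apply ex_nonneg
  intro ω
  split_ifs <;> norm_num

lemma prob_le_one (p : Ω → Prop) : prob p ≤ 1 := by
  unfold prob
  apply div_le_one_of_le₀ _ (by positivity)
  exact_mod_cast Finset.card_le_univ _

lemma prob_or (p q : Ω → Prop) : prob (fun ω => p ω ∨ q ω) ≤ prob p + prob q := by
  classical
  rw [prob_eq, prob_eq, prob_eq, ← ex_add]
  apply ex_mono
  intro ω
  split_ifs <;> first | linarith | tauto

lemma prob_exists {K : Type*} (s : Finset K) (p : K → Ω → Prop) :
    prob (fun ω => ∃ x ∈ s, p x ω) ≤ ∑ x ∈ s, prob (p x) := by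
  classical
  induction s using Finset.induction_on with
  | empty => simp [prob]
  | insert a s ha ih =>
    rw [Finset.sum_insert ha]
    calc _ ≤ prob (fun ω => p a ω ∨ ∃ x ∈ s, p x ω) := prob_mono (by
            intro ω ⟨x, hx, h⟩
            rcases Finset.mem_insert.1 hx with rfl | hx
            · exact Or.inl h
            · exact Or.inr ⟨x, hx, h⟩)
      _ ≤ _ := (prob_or _ _).trans (by linarith)

lemma prob_false {p : Ω → Prop} (H : ∀ ω, ¬ p ω) : prob p = 0 := by
  classical
  rw [prob_eq]
  simp [H, ex]

lemma prob_equiv (e : Ω ≃ Ω') (p : Ω' → Prop) : prob (fun ω => p (e ω)) = prob p := by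
  classical
  rw [prob_eq, prob_eq, ← ex_equiv e]

lemma prob_prod (p : Ω × Ω' → Prop) : prob p = ex (fun ω => prob (fun ω' => p (ω, ω'))) := by
  classical
  rw [prob_eq, ex_prod]
  simp_rw [prob_eq]

lemma prob_fst [Nonempty Ω'] (p : Ω → Prop) : prob (fun x : Ω × Ω' => p x.1) = prob p := by
  classical
  rw [prob_eq, prob_eq, ex_prod]
  congr 1
  funext ω
  exact ex_const (Ω := Ω') (if p ω then (1 : ℝ) else 0)

lemma prob_snd [Nonempty Ω] (p : Ω' → Prop) : prob (fun x : Ω × Ω' => p x.2) = prob p := by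
  rw [prob_prod]
  exact ex_const (Ω := Ω) (prob p)

lemma prob_indep (p : Ω → Prop) (q : Ω' → Prop) :
    prob (fun x : Ω × Ω' => p x.1 ∧ q x.2) = prob p * prob q := by
  classical
  rw [prob_prod, prob_eq p, mul_comm, ← ex_mul_left]
  congr 1
  funext ω
  by_cases h : p ω
  · simp [h]
  · simp only [h, false_and, if_false, mul_zero]
    exact prob_false (by simp)

lemma prob_prod_le_const [Nonempty Ω'] (p : Ω × Ω' → Prop) (c : ℝ)
    (H : ∀ w, prob (fun ω => p (ω, w)) ≤ c) : prob p ≤ c := by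
  have : prob p = prob (fun x : Ω' × Ω => p (x.2, x.1)) :=
    prob_equiv (Equiv.prodComm Ω Ω') (fun x : Ω' × Ω => p (x.2, x.1))
  rw [this, prob_prod, ← ex_const (Ω := Ω') c]
  exact ex_mono H

lemma prob_prod_ge_const [Nonempty Ω'] (p : Ω × Ω' → Prop) (c : ℝ)
    (H : ∀ w, c ≤ prob (fun ω => p (ω, w))) : c ≤ prob p := by
  have : prob p = prob (fun x : Ω' × Ω => p (x.2, x.1)) :=
    prob_equiv (Equiv.prodComm Ω Ω') (fun x : Ω' × Ω => p (x.2, x.1))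
  rw [this, prob_prod, ← ex_const (Ω := Ω') c]
  exact ex_mono H

/-- The law of `Φ` is dominated by `C` times the uniform law. -/
def Dom (C : ℝ) (Φ : Ω → Ω') : Prop := ∀ p : Ω' → Prop, prob (fun ω => p (Φ ω)) ≤ C * prob p

lemma Dom.comp {C C' : ℝ} {Φ : Ω → Ω'} {Ψ : Ω' → Ω''} (hC : 0 ≤ C) (h' : Dom C' Ψ) (h : Dom C Φ) :
    Dom (C * C') (fun ω => Ψ (Φ ω)) := by
  intro p
  calc _ ≤ C * prob (fun ω => p (Ψ ω)) := h (fun ω => p (Ψ ω))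
    _ ≤ C * (C' * prob p) := mul_le_mul_of_nonneg_left (h' p) hC
    _ = _ := by ring

lemma dom_equiv (e : Ω ≃ Ω') : Dom 1 (fun ω => e ω) := by
  intro p
  rw [prob_equiv e p, one_mul]

lemma dom_id : Dom 1 (fun ω : Ω => ω) := fun p => by rw [one_mul]

lemma dom_fst [Nonempty Ω'] : Dom 1 (fun x : Ω × Ω' => x.1) := by
  intro p
  rw [prob_fst p, one_mul]

lemma dom_snd [Nonempty Ω] : Dom 1 (fun x : Ω × Ω' => x.2) := by
  intro p
  rw [prob_snd p, one_mul]

lemma dom_of_inj {K : Type*} [Fintype K] (Φ : Ω → Ω) (κ : Ω → K)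
    (h : Function.Injective fun ω => (Φ ω, κ ω)) : Dom (Fintype.card K) Φ := by
  intro p
  classical
  unfold prob
  rw [← mul_div_assoc]
  gcongr
  have h1 : (univ.filter fun ω => p (Φ ω)).card ≤ ((univ.filter p) ×ˢ (univ : Finset K)).card := by
    apply Finset.card_le_card_of_injOn (fun ω => (Φ ω, κ ω))
    · intro ω hω
      simpa using hω
    · exact h.injOn
  rw [Finset.card_product, Finset.card_univ] at h1
  rw [mul_comm]
  exact_mod_cast h1

lemma Dom.prodMap {Ω₂ : Type*} [Fintype Ω₂] {C : ℝ} {Φ : Ω → Ω'}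
    (h : Dom C Φ) : Dom C (fun x : Ω × Ω₂ => (Φ x.1, x.2)) := by
  intro p
  have e1 : prob (fun x : Ω × Ω₂ => p (Φ x.1, x.2)) =
      ex (fun y : Ω₂ => prob (fun x : Ω => p (Φ x, y))) := by
    rw [← prob_prod (fun z : Ω₂ × Ω => p (Φ z.2, z.1))]
    exact prob_equiv (Equiv.prodComm Ω Ω₂) (fun z : Ω₂ × Ω => p (Φ z.2, z.1))
  have e2 : prob p = ex (fun y : Ω₂ => prob (fun x : Ω' => p (x, y))) := by
    rw [← prob_prod (fun z : Ω₂ × Ω' => p (z.2, z.1))]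
    exact prob_equiv (Equiv.prodComm Ω' Ω₂) (fun z : Ω₂ × Ω' => p (z.2, z.1))
  rw [e1, e2, ← ex_mul_left]
  exact ex_mono fun y => h (fun x => p (x, y))

lemma Dom.prodMap_right {Ω₂ : Type*} [Fintype Ω₂] {C : ℝ} {Φ : Ω → Ω'}
    (h : Dom C Φ) : Dom C (fun x : Ω₂ × Ω => (x.1, Φ x.2)) := by
  intro p
  rw [prob_prod, prob_prod p, ← ex_mul_left]
  exact ex_mono fun y => h (fun x => p (y, x))

end ProbBasics

/-! ## Poincaré-type inequality for adjacent transpositions -/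

section Poincare

/-- The adjacent transposition of positions `r`, `r+1` (identity if out of range). -/
def sw (k r : ℕ) : Equiv.Perm (Fin k) :=
  if h : r + 1 < k then Equiv.swap ⟨r, by omega⟩ ⟨r + 1, h⟩ else 1

lemma subadd_cycle {k : ℕ} (D : Equiv.Perm (Fin k) → ℝ) (h1 : D 1 = 0)
    (hm : ∀ u v, D (u * v) ≤ D u + D v) (p : Fin k) (q : ℕ) (hpq : (p : ℕ) ≤ q) (hq : q < k) :
    ∃ u : Equiv.Perm (Fin k), u ⟨q, hq⟩ = p ∧ (∀ r : Fin k, q < (r : ℕ) → u r = r) ∧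
      D u ≤ ∑ r ∈ Finset.Ico (p : ℕ) q, D (sw k r) := by
  induction q, hpq using Nat.le_induction with
  | base => exact ⟨1, by simp, by simp, by simp [h1]⟩
  | succ q hpq ih =>
    obtain ⟨u, hu1, hu2, hu3⟩ := ih (by omega)
    refine ⟨u * sw k q, ?_, ?_, ?_⟩
    · simp [sw, hq, hu1]
    · intro r hr
      have e : sw k q r = r := by
        rw [sw, dif_pos hq]
        apply Equiv.swap_apply_of_ne_of_ne <;> (intro h; subst h; simp at hr)
      rw [Equiv.Perm.mul_apply, e]
      exact hu2 r (by omega)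
    · rw [Finset.sum_Ico_succ_top hpq]
      exact (hm _ _).trans (by linarith)

lemma subadd_le {k : ℕ} (D : Equiv.Perm (Fin k) → ℝ) (h1 : D 1 = 0) (h0 : ∀ u, 0 ≤ D u)
    (hm : ∀ u v, D (u * v) ≤ D u + D v) (w : Equiv.Perm (Fin k)) :
    D w ≤ k * ∑ r ∈ Finset.range k, D (sw k r) := by
  set A := ∑ r ∈ Finset.range k, D (sw k r) with hA
  have key : ∀ m : ℕ, m ≤ k → ∀ w : Equiv.Perm (Fin k), (∀ r : Fin k, m ≤ (r : ℕ) → w r = r) →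
      D w ≤ m * A := by
    intro m
    induction m with
    | zero =>
      intro _ w hw
      have : w = 1 := Equiv.ext fun r => hw r (by omega)
      simp [this, h1]
    | succ m ih =>
      intro hm' w hw
      have hp : ((w ⟨m, hm'⟩ : Fin k) : ℕ) ≤ m := by
        by_contra hlt
        have h2 := hw (w ⟨m, hm'⟩) (by omega)
        have h3 := w.injective h2
        rw [h3] at hlt
        simp at hlt
      obtain ⟨u, hu1, hu2, hu3⟩ := subadd_cycle D h1 hm (w ⟨m, hm'⟩) m hp hm'
      have hu4 : D u ≤ A := hu3.trans (Finset.sum_le_sum_of_subset_of_nonneg (by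
        intro r; simp; omega) (fun _ _ _ => h0 _))
      have h5 := ih (by omega) (u⁻¹ * w) (by
        intro r hr
        rw [Equiv.Perm.mul_apply, Equiv.Perm.inv_eq_iff_eq]
        rcases Nat.eq_or_lt_of_le hr with h | h
        · have : r = ⟨m, hm'⟩ := Fin.ext h.symm
          rw [this, hu1]
        · rw [hw r h, hu2 r h])
      have h6 := hm u (u⁻¹ * w)
      rw [mul_inv_cancel_left] at h6
      push_cast
      linarith
  exact key k le_rfl w (fun r hr => absurd r.2 (by omega))

variable {n k : ℕ}

/-- Replace the coordinates in `L` of `σ` by those of `ρ`. -/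
def mix (L : Finset (Fin n)) (σ ρ : Profile n k) : Profile n k :=
  fun l => if l ∈ L then ρ l else σ l

/-- Move in coordinate `l` by the adjacent transposition number `r`. -/
def mv (l : Fin n) (r : ℕ) (σ : Profile n k) : Profile n k :=
  Function.update σ l (σ l * sw k r)

lemma mv_eq (l : Fin n) (r : ℕ) (σ : Profile n k) :
    mv l r σ = σ * Pi.mulSingle l (sw k r) := by
  funext x
  by_cases h : x = l
  · subst h; simp [mv]
  · simp [mv, h]

lemma poincare {Θ β : Type*} [Fintype Θ] (g : Θ → Profile n k → β) (L : Finset (Fin n)) :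
    prob (fun x : (Θ × Profile n k) × Profile n k => g x.1.1 x.1.2 ≠ g x.1.1 (mix L x.1.2 x.2)) ≤
      k * ∑ l ∈ L, ∑ r ∈ Finset.range k,
        prob (fun x : Θ × Profile n k => g x.1 x.2 ≠ g x.1 (mv l r x.2)) := by
  classical
  set D : Profile n k → ℝ := fun u => prob (fun x : Θ × Profile n k => g x.1 x.2 ≠ g x.1 (x.2 * u))
    with hD
  have D1 : D 1 = 0 := prob_false (by simp)
  have D0 : ∀ u, 0 ≤ D u := fun u => prob_nonneg _
  have Dm : ∀ u v, D (u * v) ≤ D u + D v := by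
    intro u v
    have e : D v = prob (fun x : Θ × Profile n k => g x.1 (x.2 * u) ≠ g x.1 (x.2 * u * v)) :=
      (prob_equiv (Equiv.prodCongr (Equiv.refl Θ) (Equiv.mulRight u))
        (fun x : Θ × Profile n k => g x.1 x.2 ≠ g x.1 (x.2 * v))).symm
    rw [e]
    refine le_trans (prob_mono ?_) (prob_or _ _)
    intro x hx
    by_contra hcon
    push Not at hcon
    apply hx
    rw [hcon.1, hcon.2, mul_assoc]
  have Dl : ∀ (l : Fin n) (w : Equiv.Perm (Fin k)), D (Pi.mulSingle l w) ≤
      k * ∑ r ∈ Finset.range k, D (Pi.mulSingle l (sw k r)) := by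
    intro l w
    apply subadd_le (fun w => D (Pi.mulSingle l w))
    · simpa using D1
    · intro u; exact D0 _
    · intro u v
      simp only [Pi.mulSingle_mul]
      exact Dm _ _
  have DL : ∀ w : Profile n k, D (fun l => if l ∈ L then w l else 1) ≤
      k * ∑ l ∈ L, ∑ r ∈ Finset.range k, D (Pi.mulSingle l (sw k r)) := by
    intro w
    induction L using Finset.induction_on with
    | empty => simpa using (show D (fun _ => 1) ≤ 0 from D1.le)
    | insert a s ha ih =>
      rw [Finset.sum_insert ha, mul_add]
      have e : (fun l => if l ∈ insert a s then w l else 1) =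
          Pi.mulSingle a (w a) * (fun l => if l ∈ s then w l else 1) := by
        funext x
        by_cases h : x = a
        · subst h; simp [ha]
        · simp [h]
      rw [e]
      exact (Dm _ _).trans (add_le_add (Dl a (w a)) ih)
  have e : prob (fun x : (Θ × Profile n k) × Profile n k =>
      g x.1.1 x.1.2 ≠ g x.1.1 (mix L x.1.2 x.2)) =
      prob (fun x : (Θ × Profile n k) × Profile n k =>
      g x.1.1 x.1.2 ≠ g x.1.1 (x.1.2 * fun l => if l ∈ L then x.2 l else 1)) := by
    let E : (Θ × Profile n k) × Profile n k ≃ (Θ × Profile n k) × Profile n k :=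
      { toFun := fun x => (x.1, x.1.2 * x.2)
        invFun := fun x => (x.1, x.1.2⁻¹ * x.2)
        left_inv := fun x => by simp
        right_inv := fun x => by simp }
    rw [← prob_equiv E]
    apply prob_congr
    intro x
    have : mix L x.1.2 (x.1.2 * x.2) = x.1.2 * fun l => if l ∈ L then x.2 l else 1 := by
      funext l
      by_cases h : l ∈ L <;> simp [mix, h]
    simp only [E, Equiv.coe_fn_mk]
    rw [this]
  rw [e]
  apply prob_prod_le_const
  intro w
  simp_rw [mv_eq]
  exact DL w

end Poincare

end QGS

namespace QGS

/-! ## Order-theoretic facts on rankings -/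

section Orders

variable {k : ℕ}

lemma above_irrefl (τ : Equiv.Perm (Fin k)) (a : Fin k) : ¬ Above τ a a := lt_irrefl _

lemma above_trans {τ : Equiv.Perm (Fin k)} {a b c : Fin k} (h : Above τ a b) (h' : Above τ b c) :
    Above τ a c := lt_trans h h'

lemma above_total (τ : Equiv.Perm (Fin k)) {a b : Fin k} (h : a ≠ b) : Above τ a b ∨ Above τ b a :=
  lt_or_gt_of_ne (fun e => h (τ.symm.injective e))

lemma above_asymm {τ : Equiv.Perm (Fin k)} {a b : Fin k} (h : Above τ a b) : ¬ Above τ b a :=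
  lt_asymm h

lemma above_mul (π τ : Equiv.Perm (Fin k)) (u v : Fin k) :
    Above (π * τ) u v ↔ Above τ (π.symm u) (π.symm v) := Iff.rfl

lemma above_swap (a b : Fin k) (τ : Equiv.Perm (Fin k)) (u v : Fin k) :
    Above (Equiv.swap a b * τ) u v ↔ Above τ (Equiv.swap a b u) (Equiv.swap a b v) := Iff.rfl

lemma perm_ext_above {τ τ' : Equiv.Perm (Fin k)} (h : ∀ u v, Above τ u v ↔ Above τ' u v) :
    τ = τ' := by
  let o : Fin k ≃o Fin k :=
    { toEquiv := τ.trans τ'.symm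
      map_rel_iff' := by
        intro u v
        have h1 := h (τ v) (τ u)
        simp only [Above, Equiv.symm_apply_apply] at h1
        simp only [Equiv.trans_apply]
        rw [← not_lt, ← h1, not_lt] }
  have : o = OrderIso.refl _ := Subsingleton.elim _ _
  apply Equiv.ext
  intro u
  have h2 : o u = u := by rw [this]; rfl
  have h3 : τ'.symm (τ u) = u := h2
  conv_rhs => rw [← h3]
  simp

/-- `τ'` is obtained from `τ` by exchanging the adjacent alternatives `x` (upper), `y` (lower). -/
def Edge (x y : Fin k) (τ τ' : Equiv.Perm (Fin k)) : Prop :=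
  Above τ x y ∧ ∀ u v, Above τ' u v ↔ ((u = y ∧ v = x) ∨ (Above τ u v ∧ ¬ (u = x ∧ v = y)))

lemma Edge.symm {x y : Fin k} {τ τ' : Equiv.Perm (Fin k)} (h : Edge x y τ τ') : Edge y x τ' τ := by
  obtain ⟨h1, h2⟩ := h
  refine ⟨(h2 y x).2 (Or.inl ⟨rfl, rfl⟩), fun u v => ?_⟩
  have := above_asymm h1
  rw [h2 u v]
  constructor
  · intro h
    by_cases e : u = x ∧ v = y
    · exact Or.inl e
    · refine Or.inr ⟨Or.inr ⟨h, e⟩, ?_⟩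
      rintro ⟨rfl, rfl⟩
      exact this h
  · rintro (⟨rfl, rfl⟩ | ⟨⟨rfl, rfl⟩ | h, h'⟩)
    · exact h1
    · exact absurd ⟨rfl, rfl⟩ h'
    · exact h.1

lemma Edge.ne {x y : Fin k} {τ τ' : Equiv.Perm (Fin k)} (h : Edge x y τ τ') : x ≠ y := by
  rintro rfl
  exact above_irrefl _ _ h.1

lemma Edge.ne' {x y : Fin k} {τ τ' : Equiv.Perm (Fin k)} (h : Edge x y τ τ') : τ ≠ τ' := by
  rintro rfl
  exact above_asymm h.1 h.symm.1

/-- No alternative lies strictly between the two exchanged ones. -/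
lemma Edge.adj {x y : Fin k} {τ τ' : Equiv.Perm (Fin k)} (h : Edge x y τ τ') (z : Fin k)
    (h1 : Above τ x z) : ¬ Above τ z y := by
  intro h2
  have hzx : z ≠ x := by rintro rfl; exact above_irrefl _ _ h1
  have hzy : z ≠ y := by rintro rfl; exact above_irrefl _ _ h2
  have e1 : Above τ' x z := (h.2 x z).2 (Or.inr ⟨h1, fun h => hzy h.2⟩)
  have e2 : Above τ' z y := (h.2 z y).2 (Or.inr ⟨h2, fun h => hzx h.1⟩)
  exact above_asymm (above_trans e1 e2) h.symm.1

/-- If `x` is immediately above `y`, relabelling gives an edge. -/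
lemma edge_swap {x y : Fin k} {τ : Equiv.Perm (Fin k)} (h : Above τ x y)
    (hadj : ∀ z, Above τ x z → ¬ Above τ z y) : Edge x y τ (Equiv.swap x y * τ) := by
  refine ⟨h, fun u v => ?_⟩
  rw [above_swap]
  have hxy : x ≠ y := by rintro rfl; exact above_irrefl _ _ h
  simp only [Equiv.swap_apply_def]
  unfold Above at *
  have inj : ∀ u v : Fin k, τ.symm u = τ.symm v → u = v := fun u v h => τ.symm.injective h
  have i1 := inj u x
  have i2 := inj u y
  have i3 := inj v x
  have i4 := inj v y
  have := hadj u
  have := hadj v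
  split_ifs <;> grind

lemma Edge.eq_swap {x y : Fin k} {τ τ' : Equiv.Perm (Fin k)} (h : Edge x y τ τ') :
    τ' = Equiv.swap x y * τ := by
  apply perm_ext_above
  intro u v
  rw [(edge_swap h.1 h.adj).2, h.2]

lemma Edge.agree {x y : Fin k} {τ τ' : Equiv.Perm (Fin k)} (h : Edge x y τ τ') :
    AgreeOutsideBlock 4 τ τ' := by
  refine ⟨(τ.symm x : ℕ), fun p hp => ?_⟩
  rw [h.eq_swap, Equiv.Perm.mul_apply]
  symm
  have h1 := h.1
  have hadj := h.adj
  unfold Above at *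
  have hy : (τ.symm y : ℕ) = τ.symm x + 1 := by
    by_contra hne
    have hlt : (τ.symm x : ℕ) + 1 < τ.symm y := by
      have : (τ.symm x : ℕ) < τ.symm y := h1
      omega
    have h3 := hadj (τ ⟨(τ.symm x : ℕ) + 1, by omega⟩)
    simp only [Equiv.symm_apply_apply] at h3
    exact h3 (by rw [Fin.lt_def]; simp) (by rw [Fin.lt_def]; exact hlt)
  apply Equiv.swap_apply_of_ne_of_ne
  · rintro rfl; simp at hp
  · rintro rfl
    simp only [Equiv.symm_apply_apply] at hy hp
    omega

/-- A position-adjacent transposition gives an edge (or nothing). -/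
lemma sw_edge (τ : Equiv.Perm (Fin k)) (r : ℕ) :
    τ * sw k r = τ ∨ ∃ x y, Edge x y τ (τ * sw k r) := by
  unfold sw
  split_ifs with h
  · right
    refine ⟨τ ⟨r, by omega⟩, τ ⟨r + 1, h⟩, ?_⟩
    have e : τ * Equiv.swap ⟨r, by omega⟩ ⟨r + 1, h⟩ =
        Equiv.swap (τ ⟨r, by omega⟩) (τ ⟨r + 1, h⟩) * τ := Equiv.mul_swap_eq_swap_mul _ _ _
    rw [e]
    apply edge_swap
    · simp [Above]
    · intro z h1 h2
      simp only [Above, Equiv.symm_apply_apply, Fin.lt_def] at h1 h2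
      omega
  · left; simp

/-! ### Moving one alternative right below another -/

/-- Remove `b` and reinsert it immediately below `a`. -/
def phi (a b : Fin k) (τ : Equiv.Perm (Fin k)) : Equiv.Perm (Fin k) :=
  Tuple.sort (fun x : Fin k => if x = b then 2 * (τ.symm a : ℕ) + 1 else 2 * (τ.symm x : ℕ))

lemma above_sort (key : Fin k → ℕ) (hk : Function.Injective key) (u v : Fin k) :
    Above (Tuple.sort key) u v ↔ key u < key v := by
  have hm : StrictMono (key ∘ Tuple.sort key) :=
    (Tuple.monotone_sort key).strictMono_of_injective (hk.comp (Tuple.sort key).injective)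
  have := hm.lt_iff_lt (a := (Tuple.sort key).symm u) (b := (Tuple.sort key).symm v)
  simp only [Function.comp, Equiv.apply_symm_apply] at this
  exact this.symm

lemma above_phi (a b : Fin k) (τ : Equiv.Perm (Fin k)) (u v : Fin k) :
    Above (phi a b τ) u v ↔
      ((u = b ∧ v ≠ b ∧ Above τ a v) ∨ (v = b ∧ u ≠ b ∧ (u = a ∨ Above τ u a)) ∨
        (u ≠ b ∧ v ≠ b ∧ Above τ u v)) := by
  have inj : ∀ u v : Fin k, (τ.symm u : ℕ) = τ.symm v → u = v :=
    fun u v h => τ.symm.injective (Fin.ext h)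
  unfold phi
  rw [above_sort]
  · unfold Above
    simp only [Fin.lt_def]
    have := inj u a
    by_cases h1 : u = b <;> by_cases h2 : v = b <;> simp only [h1, h2, if_true, if_false] <;> grind
  · intro u v h
    dsimp only at h
    have := inj u v
    split_ifs at h with h1 h2 h2
    · rw [h1, h2]
    · omega
    · omega
    · exact this (by omega)

open Classical in
lemma pos_eq (τ : Equiv.Perm (Fin k)) (u : Fin k) :
    (τ.symm u : ℕ) = (univ.filter fun v => Above τ v u).card := by
  have : (univ.filter fun v => Above τ v u) = (univ.filter fun p => p < τ.symm u).map τ.toEmbedding := by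
    ext v
    simp only [mem_filter, mem_univ, true_and, mem_map, Equiv.coe_toEmbedding]
    constructor
    · intro h; exact ⟨τ.symm v, h, by simp⟩
    · rintro ⟨p, hp, rfl⟩; simpa [Above] using hp
  rw [this, Finset.card_map]
  rw [Finset.filter_gt_eq_Iio, Fin.card_Iio]

lemma phi_inj (a b : Fin k) :
    Function.Injective fun τ : Equiv.Perm (Fin k) => (phi a b τ, τ.symm b) := by
  classical
  intro τ τ' h
  simp only [Prod.mk.injEq] at h
  obtain ⟨h1, h2⟩ := h
  have h3 : ∀ u v, u ≠ b → v ≠ b → (Above τ u v ↔ Above τ' u v) := by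
    intro u v hu hv
    have e1 := above_phi a b τ u v
    have e2 := above_phi a b τ' u v
    rw [h1] at e1
    simp only [hu, hv, false_and, false_or, ne_eq, not_false_eq_true, true_and] at e1 e2
    rw [← e1, ← e2]
  have key : ∀ (ρ : Equiv.Perm (Fin k)) (u : Fin k), u ≠ b → (ρ.symm u : ℕ) =
      (univ.filter fun v => v ≠ b ∧ Above ρ v u).card + (if Above ρ b u then 1 else 0) := by
    intro ρ u hu
    rw [pos_eq]
    have : (univ.filter fun v => Above ρ v u) =
        (univ.filter fun v => v ≠ b ∧ Above ρ v u) ∪ (if Above ρ b u then {b} else ∅) := by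
      ext v
      by_cases hv : v = b
      · subst hv
        split_ifs with h <;> simp [h]
      · split_ifs with h <;> simp [hv]
    rw [this, Finset.card_union_of_disjoint]
    · split_ifs <;> simp
    · split_ifs <;> simp
  have hpos : ∀ u, u ≠ b → (Above τ b u ↔ Above τ' b u) := by
    intro u hu
    have k1 := key τ u hu
    have k2 := key τ' u hu
    have e : (univ.filter fun v => v ≠ b ∧ Above τ v u) = (univ.filter fun v => v ≠ b ∧ Above τ' v u) := by
      ext v
      simp only [mem_filter, mem_univ, true_and]
      constructor
      · rintro ⟨x, y⟩; exact ⟨x, (h3 v u x hu).1 y⟩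
      · rintro ⟨x, y⟩; exact ⟨x, (h3 v u x hu).2 y⟩
    rw [e] at k1
    have h2' : (τ.symm b : ℕ) = τ'.symm b := by rw [h2]
    have n1 : (τ.symm u : ℕ) ≠ τ.symm b := fun h => hu (τ.symm.injective (Fin.ext h))
    have n2 : (τ'.symm u : ℕ) ≠ τ'.symm b := fun h => hu (τ'.symm.injective (Fin.ext h))
    unfold Above at *
    simp only [Fin.lt_def] at *
    split_ifs at k1 k2 <;> omega
  apply perm_ext_above
  intro u v
  by_cases hu : u = b
  · subst hu
    by_cases hv : v = u
    · subst hv; simp [above_irrefl]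
    · exact hpos v hv
  · by_cases hv : v = b
    · subst hv
      have := hpos u hu
      constructor
      · intro h
        rcases above_total τ' hu with h' | h'
        · exact h'
        · exact absurd (this.2 h') (above_asymm h)
      · intro h
        rcases above_total τ hu with h' | h'
        · exact h'
        · exact absurd (this.1 h') (above_asymm h)
    · exact h3 u v hu hv

end Orders
end QGS

namespace QGS

section Orders2

variable {k : ℕ}

lemma above_or (τ : Equiv.Perm (Fin k)) (a b : Fin k) : a = b ∨ Above τ a b ∨ Above τ b a := by
  by_cases h : a = b
  · exact Or.inl h
  · exact Or.inr (above_total τ h)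

lemma phi_self {u v : Fin k} {τ : Equiv.Perm (Fin k)} (h : Above τ u v)
    (hadj : ∀ z, Above τ u z → ¬ Above τ z v) : phi u v τ = τ := by
  apply perm_ext_above
  intro x y
  rw [above_phi]
  have hx := hadj x
  have hy := hadj y
  have t1 := above_or τ x v
  have t2 := above_or τ y v
  have t3 := above_or τ x u
  have t4 := above_or τ y u
  unfold Above at *
  grind

lemma Edge.phi_eq {x y a b : Fin k} {τ τ' : Equiv.Perm (Fin k)} (h : Edge x y τ τ') (hab : a ≠ b)
    (hb : b = x ∨ b = y) : phi a b τ = phi a b τ' := by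
  apply perm_ext_above
  intro u v
  have h2 := h.2
  rw [above_phi, above_phi, h2, h2, h2]
  grind

lemma Edge.relabel {x y : Fin k} {τ τ' : Equiv.Perm (Fin k)} (h : Edge x y τ τ')
    (π : Equiv.Perm (Fin k)) : Edge (π x) (π y) (π * τ) (π * τ') := by
  refine ⟨by simpa [above_mul] using h.1, fun u v => ?_⟩
  rw [above_mul, above_mul, h.2]
  simp [Equiv.symm_apply_eq]

lemma Edge.relabel_swap {x y a b : Fin k} {τ τ' : Equiv.Perm (Fin k)} (h : Edge x y τ τ')
    (h1 : x ≠ a) (h2 : x ≠ b) (h3 : y ≠ a) (h4 : y ≠ b) :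
    Edge x y (Equiv.swap a b * τ) (Equiv.swap a b * τ') := by
  have := h.relabel (Equiv.swap a b)
  rwa [Equiv.swap_apply_of_ne_of_ne h1 h2, Equiv.swap_apply_of_ne_of_ne h3 h4] at this

lemma Edge.phi_edge {x y a b : Fin k} {τ τ' : Equiv.Perm (Fin k)} (h : Edge x y τ τ')
    (h1 : x ≠ a) (h2 : x ≠ b) (h3 : y ≠ a) (h4 : y ≠ b) :
    Edge x y (phi a b τ) (phi a b τ') := by
  refine ⟨(above_phi _ _ _ _ _).2 (Or.inr (Or.inr ⟨h2, h4, h.1⟩)), fun u v => ?_⟩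
  rw [above_phi, above_phi, h.2, h.2, h.2]
  grind

lemma phi_above (a b : Fin k) (hab : a ≠ b) (τ : Equiv.Perm (Fin k)) : Above (phi a b τ) a b := by
  rw [above_phi]; grind

lemma phi_adj (a b : Fin k) (τ : Equiv.Perm (Fin k)) (z : Fin k)
    (h1 : Above (phi a b τ) a z) : ¬ Above (phi a b τ) z b := by
  rw [above_phi] at h1 ⊢
  unfold Above at *
  grind

lemma phi_edge (a b : Fin k) (hab : a ≠ b) (τ : Equiv.Perm (Fin k)) :
    Edge a b (phi a b τ) (Equiv.swap a b * phi a b τ) :=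
  edge_swap (phi_above a b hab τ) (phi_adj a b τ)

lemma phi_bits {a b c d : Fin k} (h1 : d ≠ a) (h2 : d ≠ b) (τ : Equiv.Perm (Fin k)) :
    Above (phi c d τ) a b ↔ Above τ a b := by
  rw [above_phi]; grind

lemma phi_relabel (a b : Fin k) (π τ : Equiv.Perm (Fin k)) :
    phi (π a) (π b) (π * τ) = π * phi a b τ := by
  apply perm_ext_above
  intro u v
  simp only [above_phi, above_mul]
  simp [Equiv.symm_apply_eq]

lemma phi_relabel_swap (a b : Fin k) (τ : Equiv.Perm (Fin k)) :
    phi b a (Equiv.swap a b * τ) = Equiv.swap a b * phi a b τ := by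
  have := phi_relabel a b (Equiv.swap a b) τ
  simpa using this

/-- `a, b, c` are consecutive. -/
def Blk (a b c : Fin k) (τ : Equiv.Perm (Fin k)) : Prop :=
  Edge a b τ (Equiv.swap a b * τ) ∧ Edge b c τ (Equiv.swap b c * τ)

lemma Blk.relabel {a b c : Fin k} {τ : Equiv.Perm (Fin k)} (h : Blk a b c τ)
    (π : Equiv.Perm (Fin k)) : Blk (π a) (π b) (π c) (π * τ) := by
  obtain ⟨h1, h2⟩ := h
  have e1 := h1.relabel π
  have e2 := h2.relabel π
  exact ⟨edge_swap e1.1 e1.adj, edge_swap e2.1 e2.adj⟩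

lemma phi_phi_blk (a b c : Fin k) (hab : a ≠ b) (hac : a ≠ c) (hbc : b ≠ c)
    (τ : Equiv.Perm (Fin k)) : Blk a b c (phi a b (phi a c τ)) := by
  refine ⟨phi_edge a b hab _, edge_swap ?_ ?_⟩
  · simp only [above_phi]; grind
  · intro z
    simp only [above_phi]
    unfold Above
    grind

/-- The six relabelings of a block in cyclic order: abc, acb, cab, cba, bca, bac. -/
def six (a b c : Fin k) : Fin 6 → Equiv.Perm (Fin k) :=
  ![1, Equiv.swap b c, Equiv.swap a c * Equiv.swap b c, Equiv.swap a c,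
    Equiv.swap a c * Equiv.swap a b, Equiv.swap a b]

lemma Blk.edges {a b c : Fin k} (hab : a ≠ b) (hac : a ≠ c) (hbc : b ≠ c)
    {τ : Equiv.Perm (Fin k)} (h : Blk a b c τ) :
    Edge b c (six a b c 0 * τ) (six a b c 1 * τ) ∧ Edge a c (six a b c 1 * τ) (six a b c 2 * τ) ∧
    Edge a b (six a b c 2 * τ) (six a b c 3 * τ) ∧ Edge b c (six a b c 4 * τ) (six a b c 3 * τ) ∧
    Edge a c (six a b c 5 * τ) (six a b c 4 * τ) ∧ Edge a b (six a b c 0 * τ) (six a b c 5 * τ) := by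
  have e3 : Equiv.swap a b * (Equiv.swap a c * Equiv.swap b c) = Equiv.swap a c := by
    ext x
    simp only [Equiv.Perm.mul_apply, Equiv.swap_apply_def]
    grind
  have e4 : Equiv.swap b c * (Equiv.swap a c * Equiv.swap a b) = Equiv.swap a c := by
    ext x
    simp only [Equiv.Perm.mul_apply, Equiv.swap_apply_def]
    grind
  have s0 : six a b c 0 = 1 := rfl
  have s1 : six a b c 1 = Equiv.swap b c := rfl
  have s2 : six a b c 2 = Equiv.swap a c * Equiv.swap b c := rfl
  have s3 : six a b c 3 = Equiv.swap a c := rfl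
  have s4 : six a b c 4 = Equiv.swap a c * Equiv.swap a b := rfl
  have s5 : six a b c 5 = Equiv.swap a b := rfl
  have sw1 : ∀ {x y z : Fin k}, x ≠ z → y ≠ z → Equiv.swap x y z = z := fun h h' =>
    Equiv.swap_apply_of_ne_of_ne h.symm h'.symm
  have b1 := h.relabel (Equiv.swap b c)
  rw [Equiv.swap_apply_left, Equiv.swap_apply_right, sw1 hab.symm hac.symm] at b1
  have b5 := h.relabel (Equiv.swap a b)
  rw [Equiv.swap_apply_left, Equiv.swap_apply_right, sw1 hac hbc] at b5
  have b2 := b1.relabel (Equiv.swap a c)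
  rw [Equiv.swap_apply_left, Equiv.swap_apply_right, sw1 hab hbc.symm] at b2
  have b4 := b5.relabel (Equiv.swap a c)
  rw [Equiv.swap_apply_left, Equiv.swap_apply_right, sw1 hab hbc.symm] at b4
  rw [s0, s1, s2, s3, s4, s5, one_mul]
  refine ⟨h.2, ?_, ?_, ?_, ?_, h.1⟩
  · rw [mul_assoc]; exact b1.1
  · have := b2.2
    rw [← mul_assoc (Equiv.swap a c), ← mul_assoc, e3] at this
    exact this
  · have := b4.1
    rw [← mul_assoc (Equiv.swap a c), ← mul_assoc, e4] at this
    exact this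
  · rw [mul_assoc]; exact b5.2

/-- Effect of `phi a b` along an edge `a c`. -/
lemma Edge.phi_mid {a b c : Fin k} {τ τ' : Equiv.Perm (Fin k)} (h : Edge a c τ τ') (hab : a ≠ b)
    (hbc : b ≠ c) : phi a b (phi a c τ) = phi a b τ ∧ phi a b τ' = six a b c 2 * phi a b τ ∧
      Equiv.swap a b * phi a b τ' = six a b c 3 * phi a b τ := by
  have e : phi a c τ = τ := phi_self h.1 h.adj
  have hac := h.ne
  have hB := phi_phi_blk a b c hab hac hbc τ
  rw [e] at hB
  have hE := hB.edges hab hac hbc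
  have key : phi a b τ' = six a b c 2 * phi a b τ := by
    have e1 := hE.1
    have e2 := hE.2.1
    apply perm_ext_above
    intro u v
    rw [e2.2, e1.2, show six a b c 0 = 1 from rfl, one_mul, above_phi, above_phi, h.2, h.2, h.2]
    have t0 := h.1
    have t1 := h.adj u
    have t2 := h.adj v
    have t3 := above_or τ u a
    have t4 := above_or τ v a
    have t5 := above_or τ u c
    have t6 := above_or τ v c
    have t7 := above_or τ u v
    unfold Above at *
    clear hE e1 e2 hB e h
    by_cases hu : u = b <;> by_cases hv : v = b <;> by_cases hu2 : u = c <;> by_cases hv2 : v = c <;> grind (splits := 25)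
  refine ⟨by rw [e], key, ?_⟩
  rw [hE.2.2.1.eq_swap, key]

/-- Align the `a,b` bit of `ρ` with that of `τ`. -/
noncomputable def al (a b : Fin k) (τ ρ : Equiv.Perm (Fin k)) : Equiv.Perm (Fin k) := by
  classical exact if (Above τ a b ↔ Above ρ a b) then ρ else Equiv.swap a b * ρ

open Classical in
lemma al_def (a b : Fin k) (τ ρ : Equiv.Perm (Fin k)) : al a b τ ρ =
    if (Above τ a b ↔ Above ρ a b) then ρ else Equiv.swap a b * ρ := rfl

lemma above_swap_self (a b : Fin k) (ρ : Equiv.Perm (Fin k)) :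
    Above (Equiv.swap a b * ρ) a b ↔ Above ρ b a := by
  rw [above_swap, Equiv.swap_apply_left, Equiv.swap_apply_right]

lemma al_bit {a b : Fin k} (hab : a ≠ b) (τ ρ : Equiv.Perm (Fin k)) :
    Above (al a b τ ρ) a b ↔ Above τ a b := by
  unfold al
  split_ifs with h
  · exact h.symm
  · rw [above_swap_self]
    have := above_total ρ hab
    have := @above_asymm _ ρ a b
    tauto

lemma al_congr {a b : Fin k} {τ τ' : Equiv.Perm (Fin k)} (h : Above τ a b ↔ Above τ' a b)
    (ρ : Equiv.Perm (Fin k)) : al a b τ ρ = al a b τ' ρ := by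
  unfold al
  rw [h]

lemma al_al {a b : Fin k} (hab : a ≠ b) (τ ρ : Equiv.Perm (Fin k)) :
    al a b (al a b τ ρ) (al a b ρ τ) = τ := by
  rw [al_def, al_bit hab, al_bit hab]
  by_cases h : (Above τ a b ↔ Above ρ a b)
  · rw [if_pos h, al_def, if_pos h.symm]
  · rw [if_neg h, al_def, if_neg (fun e => h e.symm)]
    simp [← mul_assoc]

lemma Edge.al_edge {a b x y : Fin k} (hab : a ≠ b) {ρ ρ' : Equiv.Perm (Fin k)} (h : Edge x y ρ ρ')
    (τ : Equiv.Perm (Fin k)) : al a b τ ρ = al a b τ ρ' ∨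
      ∃ x' y', Edge x' y' (al a b τ ρ) (al a b τ ρ') ∧ ¬ (x' = a ∧ y' = b) ∧ ¬ (x' = b ∧ y' = a) := by
  by_cases h1 : (x = a ∧ y = b) ∨ (x = b ∧ y = a)
  · left
    have e : ρ' = Equiv.swap a b * ρ := by
      rcases h1 with ⟨rfl, rfl⟩ | ⟨rfl, rfl⟩
      · exact h.eq_swap
      · rw [Equiv.swap_comm]; exact h.eq_swap
    have e2 : Above ρ' a b ↔ ¬ Above ρ a b := by
      rw [e, above_swap_self]
      have := above_total ρ hab
      have := @above_asymm _ ρ a b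
      tauto
    unfold al
    rw [e2, e]
    have : (Above τ a b ↔ ¬ Above ρ a b) ↔ ¬ (Above τ a b ↔ Above ρ a b) := by tauto
    by_cases h3 : (Above τ a b ↔ Above ρ a b)
    · rw [if_pos h3, if_neg (by tauto)]
      simp [← mul_assoc]
    · rw [if_neg h3, if_pos (by tauto)]
  · right
    push Not at h1
    have hb : Above ρ' a b ↔ Above ρ a b := by
      rw [h.2]
      grind
    unfold al
    rw [hb]
    split_ifs with h3
    · exact ⟨x, y, h, by tauto, by tauto⟩
    · refine ⟨_, _, h.relabel (Equiv.swap a b), ?_, ?_⟩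
      all_goals
        simp only [Equiv.swap_apply_def]
        grind

/-- Every alternative below `d` has an immediate predecessor. -/
lemma exists_pred {d y : Fin k} {τ : Equiv.Perm (Fin k)} (h : Above τ d y) :
    ∃ y', Above τ y' y ∧ (∀ z, Above τ y' z → ¬ Above τ z y) ∧ (y' = d ∨ Above τ d y') ∧
      (τ.symm y' : ℕ) < τ.symm y := by
  have hlt : (τ.symm d : ℕ) < τ.symm y := h
  have hy := (τ.symm y).2
  refine ⟨τ ⟨(τ.symm y : ℕ) - 1, by omega⟩, ?_, ?_, ?_, ?_⟩
  · simp only [Above, Equiv.symm_apply_apply, Fin.lt_def]; omega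
  · intro z
    simp only [Above, Equiv.symm_apply_apply, Fin.lt_def]; omega
  · by_cases e : (τ.symm d : ℕ) = (τ.symm y : ℕ) - 1
    · left
      rw [← Equiv.eq_symm_apply]
      exact Fin.ext e.symm
    · right
      simp only [Above, Equiv.symm_apply_apply, Fin.lt_def]; omega
  · simp only [Equiv.symm_apply_apply]; omega

lemma edge_phi_down {d y : Fin k} {τ : Equiv.Perm (Fin k)} (h : Above τ d y)
    (hadj : ∀ z, Above τ d z → ¬ Above τ z y) : Edge d y τ (phi y d τ) := by
  refine ⟨h, fun u v => ?_⟩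
  rw [above_phi]
  have t1 := hadj u
  have t2 := hadj v
  have t3 := above_or τ u d
  have t4 := above_or τ v d
  have t5 := above_or τ u y
  have t6 := above_or τ v y
  unfold Above at *
  grind

lemma edge_phi_step {d y y' : Fin k} {τ : Equiv.Perm (Fin k)} (hd : Above τ d y')
    (h : Above τ y' y) (hadj : ∀ z, Above τ y' z → ¬ Above τ z y) :
    Edge d y (phi y' d τ) (phi y d τ) := by
  have n1 : d ≠ y' := by rintro rfl; exact above_irrefl _ _ hd
  have n2 : y' ≠ y := by rintro rfl; exact above_irrefl _ _ h
  have n3 : d ≠ y := by rintro rfl; exact above_asymm h hd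
  refine ⟨by rw [above_phi]; grind, fun u v => ?_⟩
  rw [above_phi, above_phi]
  have t1 := hadj u
  have t2 := hadj v
  have t5 := above_or τ u y
  have t6 := above_or τ v y
  have t7 := above_or τ u y'
  have t8 := above_or τ v y'
  unfold Above at *
  grind

end Orders2
end QGS

namespace QGS

/-! ## Consequences of local non-manipulability -/

section Local

variable {n k : ℕ}

open Function (update)

lemma edge_lem {f : Profile n k → Fin k} {x y : Fin k} {σ : Profile n k} {l : Fin n}
    {τ τ' : Equiv.Perm (Fin k)} (h : Edge x y τ τ') (h1 : ¬ IsManipPointR 4 f (update σ l τ))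
    (h2 : ¬ IsManipPointR 4 f (update σ l τ')) :
    f (update σ l τ) = f (update σ l τ') ∨ (f (update σ l τ) = x ∧ f (update σ l τ') = y) := by
  have m1 : ¬ Above τ (f (update σ l τ')) (f (update σ l τ)) := by
    intro hA
    apply h1
    refine ⟨update σ l τ', l, ⟨by simpa using h.ne', ?_, by simpa using hA⟩, by simpa using h.agree⟩
    intro j hj
    simp [hj]
  have m2 : ¬ Above τ' (f (update σ l τ)) (f (update σ l τ')) := by
    intro hA
    apply h2
    refine ⟨update σ l τ, l, ⟨by simpa using h.ne'.symm, ?_, by simpa using hA⟩,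
      by simpa using h.symm.agree⟩
    intro j hj
    simp [hj]
  rcases above_or τ (f (update σ l τ)) (f (update σ l τ')) with h3 | h3 | h3
  · exact Or.inl h3
  · right
    rw [h.2] at m2
    tauto
  · exact absurd h3 m1

/-- The pair `a,b` is pivotal at voter `i`. -/
def EE (f : Profile n k → Fin k) (i : Fin n) (a b : Fin k) (σ : Profile n k) : Prop :=
  f (update σ i (phi a b (σ i))) = a ∧ f (update σ i (Equiv.swap a b * phi a b (σ i))) = b

/-- Outcomes for the six arrangements of a block. -/
def val6 (a b c : Fin k) : Fin 6 → Fin k := ![a, a, c, c, b, b]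

/-- The winner among `a,b,c` is dictated by voter `i`. -/
def TT (f : Profile n k → Fin k) (i : Fin n) (a b c : Fin k) (σ : Profile n k) : Prop :=
  ∀ s : Fin 6, f (update σ i (six a b c s * phi a b (phi a c (σ i)))) = val6 a b c s

def BadE (f : Profile n k → Fin k) (i : Fin n) (a b : Fin k) (σ : Profile n k) : Prop :=
  ∃ c ∈ (univ : Finset (Fin k)), ∃ s ∈ (univ : Finset (Fin 6)),
    IsManipPointR 4 f (update σ i (six a b c s * phi a b (σ i)))

def BadT (f : Profile n k → Fin k) (i : Fin n) (a b c : Fin k) (σ : Profile n k) : Prop :=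
  ∃ s ∈ (univ : Finset (Fin 6)),
    IsManipPointR 4 f (update σ i (six a b c s * phi a b (phi a c (σ i))))

lemma forall6 {p : Fin 6 → Prop} : (∀ s, p s) ↔ (p 0 ∧ p 1 ∧ p 2 ∧ p 3 ∧ p 4 ∧ p 5) := by
  constructor
  · intro h; exact ⟨h 0, h 1, h 2, h 3, h 4, h 5⟩
  · rintro ⟨h0, h1, h2, h3, h4, h5⟩ s
    fin_cases s <;> assumption

lemma E_other {f : Profile n k → Fin k} {a b u v : Fin k} (hab : a ≠ b) {i l : Fin n} (hl : l ≠ i)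
    {σ : Profile n k} {τ' : Equiv.Perm (Fin k)} (h : Edge u v (σ l) τ') (h1 : ¬ (u = a ∧ v = b))
    (h2 : ¬ (u = b ∧ v = a)) (b1 : ¬ BadE f i a b σ) (b2 : ¬ BadE f i a b (update σ l τ')) :
    EE f i a b σ ↔ EE f i a b (update σ l τ') := by
  have n1 : ∀ s, ¬ IsManipPointR 4 f (update σ i (six a b a s * phi a b (σ i))) :=
    fun s hs => b1 ⟨a, mem_univ _, s, mem_univ _, hs⟩
  have n2 : ∀ s, ¬ IsManipPointR 4 f (update (update σ l τ') i (six a b a s * phi a b (σ i))) := by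
    intro s hs
    refine b2 ⟨a, mem_univ _, s, mem_univ _, ?_⟩
    rwa [Function.update_of_ne hl.symm]
  have key : ∀ s, f (update σ i (six a b a s * phi a b (σ i))) =
      f (update (update σ l τ') i (six a b a s * phi a b (σ i))) ∨
      (f (update σ i (six a b a s * phi a b (σ i))) = u ∧
      f (update (update σ l τ') i (six a b a s * phi a b (σ i))) = v) := by
    intro s
    have e : update σ i (six a b a s * phi a b (σ i)) =
        update (update σ i (six a b a s * phi a b (σ i))) l (σ l) := by
      rw [Function.update_comm hl.symm, Function.update_eq_self]
    have e' : update (update σ l τ') i (six a b a s * phi a b (σ i)) =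
        update (update σ i (six a b a s * phi a b (σ i))) l τ' := by
      rw [Function.update_comm hl.symm]
    have hn1 := n1 s
    have hn2 := n2 s
    rw [e'] at hn2 ⊢
    rw [e] at hn1
    have := edge_lem h hn1 hn2
    rwa [← e] at this
  have hE := phi_edge a b hab (σ i)
  unfold EE
  rw [Function.update_of_ne hl.symm]
  have s0 : ∀ τ, six a b a 0 * τ = τ := fun τ => one_mul τ
  have s5 : six a b a 5 = Equiv.swap a b := rfl
  have k0 := key 0
  have k5 := key 5
  have n10 := n1 0
  have n15 := n1 5
  have n20 := n2 0
  have n25 := n2 5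
  simp only [s0, s5] at k0 k5 n10 n15 n20 n25
  have q1 := edge_lem hE n10 n15
  have q2 := edge_lem hE n20 n25
  grind

lemma E_same {f : Profile n k → Fin k} {a b c : Fin k} (hab : a ≠ b) (hbc : b ≠ c) {i : Fin n}
    {σ : Profile n k} {τ' : Equiv.Perm (Fin k)} (h : Edge a c (σ i) τ')
    (b1 : ¬ BadE f i a b σ) (h3 : ¬ TT f i a b c σ) :
    EE f i a b σ ↔ EE f i a b (update σ i τ') := by
  have hac := h.ne
  have n1 : ∀ s, ¬ IsManipPointR 4 f (update σ i (six a b c s * phi a b (σ i))) :=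
    fun s hs => b1 ⟨c, mem_univ _, s, mem_univ _, hs⟩
  obtain ⟨e1, e2, e3⟩ := h.phi_mid hab hbc
  have hB := phi_phi_blk a b c hab hac hbc (σ i)
  unfold TT at h3
  rw [e1] at hB h3
  obtain ⟨g1, g2, g3, g4, g5, g6⟩ := hB.edges hab hac hbc
  have q1 := edge_lem g1 (n1 _) (n1 _)
  have q2 := edge_lem g2 (n1 _) (n1 _)
  have q3 := edge_lem g3 (n1 _) (n1 _)
  have q4 := edge_lem g4 (n1 _) (n1 _)
  have q5 := edge_lem g5 (n1 _) (n1 _)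
  have q6 := edge_lem g6 (n1 _) (n1 _)
  rw [forall6] at h3
  unfold EE
  simp only [Function.update_self, Function.update_idem]
  rw [e3, e2]
  have s0 : phi a b (σ i) = six a b c 0 * phi a b (σ i) := (one_mul _).symm
  have s5 : six a b c 5 = Equiv.swap a b := rfl
  rw [← s5]
  have t0 : f (update σ i (phi a b (σ i))) = f (update σ i (six a b c 0 * phi a b (σ i))) := by
    rw [← s0]
  rw [t0]
  have v0 : val6 a b c 0 = a := rfl
  have v1 : val6 a b c 1 = a := rfl
  have v2 : val6 a b c 2 = c := rfl
  have v3 : val6 a b c 3 = c := rfl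
  have v4 : val6 a b c 4 = b := rfl
  have v5 : val6 a b c 5 = b := rfl
  rw [v0, v1, v2, v3, v4, v5] at h3
  clear b1 e1 e2 e3 hB g1 g2 g3 g4 g5 g6 n1 h v0 v1 v2 v3 v4 v5 s0 s5 t0
  generalize f (update σ i (six a b c 0 * phi a b (σ i))) = w0 at *
  generalize f (update σ i (six a b c 1 * phi a b (σ i))) = w1 at *
  generalize f (update σ i (six a b c 2 * phi a b (σ i))) = w2 at *
  generalize f (update σ i (six a b c 3 * phi a b (σ i))) = w3 at *
  generalize f (update σ i (six a b c 4 * phi a b (σ i))) = w4 at *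
  generalize f (update σ i (six a b c 5 * phi a b (σ i))) = w5 at *
  constructor
  · rintro ⟨rfl, rfl⟩
    grind
  · rintro ⟨rfl, rfl⟩
    grind

lemma E_lem {f : Profile n k → Fin k} {a b u v : Fin k} (hab : a ≠ b) {i l : Fin n}
    {σ : Profile n k} {τ' : Equiv.Perm (Fin k)} (h : Edge u v (σ l) τ') (h1 : ¬ (u = a ∧ v = b))
    (h2 : ¬ (u = b ∧ v = a)) (b1 : ¬ BadE f i a b σ) (b2 : ¬ BadE f i a b (update σ l τ'))
    (ht : l = i → ∀ c, c ≠ a → c ≠ b → ¬ TT f i a b c σ ∧ ¬ TT f i a b c (update σ l τ')) :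
    EE f i a b σ ↔ EE f i a b (update σ l τ') := by
  by_cases hl : l = i
  · subst hl
    by_cases hb : b = u ∨ b = v
    · have e := h.phi_eq hab hb
      unfold EE
      simp only [Function.update_self, Function.update_idem]
      rw [e]
    · push Not at hb
      by_cases hu : u = a
      · subst hu
        exact E_same hab hb.2 h b1 (ht rfl v h.ne.symm hb.2.symm).1
      · by_cases hv : v = a
        · subst hv
          have := E_same (σ := update σ l τ') (τ' := σ l) hab hb.1 (by simpa using h.symm) b2
            (ht rfl u h.ne hb.1.symm).2
          simpa using this.symm
        · have g := h.phi_edge hu hb.1.symm hv hb.2.symm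
          have g' := g.relabel_swap hu hb.1.symm hv hb.2.symm
          have hE := phi_edge a b hab (σ l)
          have hE' := phi_edge a b hab τ'
          have n1 : ∀ s, ¬ IsManipPointR 4 f (update σ l (six a b a s * phi a b (σ l))) :=
            fun s hs => b1 ⟨a, mem_univ _, s, mem_univ _, hs⟩
          have n2 : ∀ s, ¬ IsManipPointR 4 f (update σ l (six a b a s * phi a b τ')) := by
            intro s hs
            exact b2 ⟨a, mem_univ _, s, mem_univ _, by simpa using hs⟩
          have s0 : ∀ τ, six a b a 0 * τ = τ := fun τ => one_mul τ
          have s5 : six a b a 5 = Equiv.swap a b := rfl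
          have n10 := n1 0
          have n15 := n1 5
          have n20 := n2 0
          have n25 := n2 5
          simp only [s0, s5] at n10 n15 n20 n25
          have q1 := edge_lem g n10 n20
          have q2 := edge_lem g' n15 n25
          have q3 := edge_lem hE n10 n15
          have q4 := edge_lem hE' n20 n25
          unfold EE
          simp only [Function.update_self, Function.update_idem]
          grind
  · exact E_other hab hl h h1 h2 b1 b2

lemma T_lem1 {f : Profile n k → Fin k} {a b c u v : Fin k} (hab : a ≠ b) (hac : a ≠ c) (hbc : b ≠ c)
    {i l : Fin n} (hl : l ≠ i)
    {σ : Profile n k} {τ' : Equiv.Perm (Fin k)} (h : Edge u v (σ l) τ')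
    (b1 : ¬ BadT f i a b c σ) (b2 : ¬ BadT f i a b c (update σ l τ')) :
    TT f i a b c σ → TT f i a b c (update σ l τ') := by
  intro hT
  have n1 : ∀ s, ¬ IsManipPointR 4 f (update σ i (six a b c s * phi a b (phi a c (σ i)))) :=
    fun s hs => b1 ⟨s, mem_univ _, hs⟩
  have n2 : ∀ s, ¬ IsManipPointR 4 f
      (update (update σ l τ') i (six a b c s * phi a b (phi a c (σ i)))) := by
    intro s hs
    refine b2 ⟨s, mem_univ _, ?_⟩
    rwa [Function.update_of_ne hl.symm]
  unfold TT at hT ⊢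
  rw [Function.update_of_ne hl.symm]
  have hB := phi_phi_blk a b c hab hac hbc (σ i)
  obtain ⟨g1, g2, g3, g4, g5, g6⟩ := hB.edges hab hac hbc
  generalize phi a b (phi a c (σ i)) = τ0 at *
  have key : ∀ s, f (update σ i (six a b c s * τ0)) =
      f (update (update σ l τ') i (six a b c s * τ0)) ∨
      (f (update σ i (six a b c s * τ0)) = u ∧
      f (update (update σ l τ') i (six a b c s * τ0)) = v) := by
    intro s
    have e : update σ i (six a b c s * τ0) =
        update (update σ i (six a b c s * τ0)) l (σ l) := by
      rw [Function.update_comm hl.symm, Function.update_eq_self]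
    have e' : update (update σ l τ') i (six a b c s * τ0) =
        update (update σ i (six a b c s * τ0)) l τ' := by
      rw [Function.update_comm hl.symm]
    have hn1 := n1 s
    have hn2 := n2 s
    rw [e'] at hn2 ⊢
    rw [e] at hn1
    have := edge_lem h hn1 hn2
    rwa [← e] at this
  have q1 := edge_lem g1 (n2 _) (n2 _)
  have q2 := edge_lem g2 (n2 _) (n2 _)
  have q3 := edge_lem g3 (n2 _) (n2 _)
  have q4 := edge_lem g4 (n2 _) (n2 _)
  have q5 := edge_lem g5 (n2 _) (n2 _)
  have q6 := edge_lem g6 (n2 _) (n2 _)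
  have key' := fun s => (hT s) ▸ (key s)
  rw [forall6] at key' ⊢
  have v0 : val6 a b c 0 = a := rfl
  have v1 : val6 a b c 1 = a := rfl
  have v2 : val6 a b c 2 = c := rfl
  have v3 : val6 a b c 3 = c := rfl
  have v4 : val6 a b c 4 = b := rfl
  have v5 : val6 a b c 5 = b := rfl
  rw [v0, v1, v2, v3, v4, v5] at key' ⊢
  have huv := h.ne
  clear key hT n1 n2 b1 b2 hB g1 g2 g3 g4 g5 g6 v0 v1 v2 v3 v4 v5 h
  generalize f (update (update σ l τ') i (six a b c 0 * τ0)) = w0 at *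
  generalize f (update (update σ l τ') i (six a b c 1 * τ0)) = w1 at *
  generalize f (update (update σ l τ') i (six a b c 2 * τ0)) = w2 at *
  generalize f (update (update σ l τ') i (six a b c 3 * τ0)) = w3 at *
  generalize f (update (update σ l τ') i (six a b c 4 * τ0)) = w4 at *
  generalize f (update (update σ l τ') i (six a b c 5 * τ0)) = w5 at *
  obtain ⟨k0, k1, k2, k3, k4, k5⟩ := key'
  by_cases ha : u = a
  · subst ha
    grind
  · by_cases hb : u = b
    · subst hb
      grind
    · by_cases hc : u = c
      · subst hc
        grind
      · grind

lemma T_lem {f : Profile n k → Fin k} {a b c u v : Fin k} (hab : a ≠ b) (hac : a ≠ c) (hbc : b ≠ c)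
    {i l : Fin n} (hl : l ≠ i)
    {σ : Profile n k} {τ' : Equiv.Perm (Fin k)} (h : Edge u v (σ l) τ')
    (b1 : ¬ BadT f i a b c σ) (b2 : ¬ BadT f i a b c (update σ l τ')) :
    TT f i a b c σ ↔ TT f i a b c (update σ l τ') := by
  refine ⟨T_lem1 hab hac hbc hl h b1 b2, fun hT => ?_⟩
  have := T_lem1 (σ := update σ l τ') (τ' := σ l) (u := v) (v := u) hab hac hbc hl
    (by simpa using h.symm) b2 (by simpa using b1) hT
  simpa using this

/-- Moving `d` down does not change an outcome different from `d`. -/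
lemma down_lem {f : Profile n k → Fin k} {d x : Fin k} {i : Fin n} {σ : Profile n k}
    {τ : Equiv.Perm (Fin k)} (h1 : ¬ IsManipPointR 4 f (update σ i τ))
    (h2 : ∀ y, ¬ IsManipPointR 4 f (update σ i (phi y d τ))) (hx : f (update σ i τ) = x)
    (hxd : x ≠ d) (y : Fin k) (hy : Above τ d y) : f (update σ i (phi y d τ)) = x := by
  have key : ∀ N : ℕ, ∀ y, (τ.symm y : ℕ) < N → Above τ d y → f (update σ i (phi y d τ)) = x := by
    intro N
    induction N with
    | zero => intro y hy; omega
    | succ N ih =>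
      intro y hN hy
      obtain ⟨y', p1, p2, p3, p4⟩ := exists_pred hy
      rcases p3 with rfl | p3
      · have := edge_lem (edge_phi_down p1 p2) h1 (h2 y)
        grind
      · have e1 := ih y' (by omega) p3
        have := edge_lem (edge_phi_step p3 p1 p2) (h2 y') (h2 y)
        grind
  exact key _ y (Nat.lt_succ_self _) hy

end Local
end QGS

namespace QGS

/-! ## Approximate invariance -/

section Inv

variable {n k : ℕ}

open Function (update)

instance : Nonempty (Profile n k) := ⟨fun _ => 1⟩

lemma dom_upd {C : ℝ} {Φ : Equiv.Perm (Fin k) → Equiv.Perm (Fin k)} (h : Dom C Φ) (i : Fin n) :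
    Dom C (fun σ : Profile n k => update σ i (Φ (σ i))) := by
  intro p
  let e := Equiv.funSplitAt i (Equiv.Perm (Fin k))
  have h1 := (h.prodMap (Ω₂ := {j // j ≠ i} → Equiv.Perm (Fin k))) (fun x => p (e.symm x))
  have h2 : prob (fun x => p (e.symm x)) = prob p := prob_equiv e.symm p
  have h3 : prob (fun σ : Profile n k => p (update σ i (Φ (σ i)))) =
      prob (fun x : _ × ({j // j ≠ i} → Equiv.Perm (Fin k)) => p (e.symm (Φ x.1, x.2))) := by
    rw [← prob_equiv e]
    apply prob_congr
    intro σ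
    have : update σ i (Φ (σ i)) = e.symm (Φ (e σ).1, (e σ).2) := by
      funext j
      by_cases hj : j = i
      · subst hj
        simp [e, Equiv.funSplitAt]
      · simp [e, Equiv.funSplitAt, hj]
    rw [this]
  rw [h3, ← h2]
  exact h1

lemma dom_phi (a b : Fin k) : Dom (k : ℝ) (phi a b) := by
  have := dom_of_inj (phi a b) (fun τ => τ.symm b) (phi_inj a b)
  simpa using this

lemma dom_lmul (π : Equiv.Perm (Fin k)) : Dom 1 (fun τ : Equiv.Perm (Fin k) => π * τ) :=
  dom_equiv (Equiv.mulLeft π)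

lemma dom_lmul_phi (π : Equiv.Perm (Fin k)) (a b : Fin k) :
    Dom (k : ℝ) (fun τ : Equiv.Perm (Fin k) => π * phi a b τ) := by
  have := (dom_lmul π).comp (by positivity) (dom_phi a b)
  simpa using this

lemma dom_lmul_phi2 (π : Equiv.Perm (Fin k)) (a b c : Fin k) :
    Dom ((k : ℝ) ^ 2) (fun τ : Equiv.Perm (Fin k) => π * phi a b (phi a c τ)) := by
  have := (dom_lmul_phi π a b).comp (by positivity) (dom_phi a c)
  rwa [← sq] at this

/-- The manipulation probability. -/
noncomputable def mm (f : Profile n k → Fin k) : ℝ := prob (fun σ => IsManipPointR 4 f σ)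

lemma mm_nonneg (f : Profile n k → Fin k) : 0 ≤ mm f := prob_nonneg _

lemma prob_BadE (f : Profile n k → Fin k) (i : Fin n) (a b : Fin k) :
    prob (BadE f i a b) ≤ 6 * (k : ℝ) ^ 2 * mm f := by
  unfold BadE
  calc _ ≤ ∑ c : Fin k, prob (fun σ : Profile n k => ∃ s ∈ (univ : Finset (Fin 6)),
          IsManipPointR 4 f (update σ i (six a b c s * phi a b (σ i)))) := prob_exists _ _
    _ ≤ ∑ c : Fin k, ∑ s : Fin 6, prob (fun σ : Profile n k =>
          IsManipPointR 4 f (update σ i (six a b c s * phi a b (σ i)))) :=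
        Finset.sum_le_sum fun c _ => prob_exists _ _
    _ ≤ ∑ c : Fin k, ∑ s : Fin 6, (k : ℝ) * mm f :=
        Finset.sum_le_sum fun c _ => Finset.sum_le_sum fun s _ =>
          dom_upd (dom_lmul_phi (six a b c s) a b) i _
    _ = _ := by simp; ring

lemma prob_BadT (f : Profile n k → Fin k) (i : Fin n) (a b c : Fin k) :
    prob (BadT f i a b c) ≤ 6 * (k : ℝ) ^ 2 * mm f := by
  unfold BadT
  calc _ ≤ ∑ s : Fin 6, prob (fun σ : Profile n k =>
          IsManipPointR 4 f (update σ i (six a b c s * phi a b (phi a c (σ i))))) := prob_exists _ _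
    _ ≤ ∑ s : Fin 6, (k : ℝ) ^ 2 * mm f :=
        Finset.sum_le_sum fun s _ => dom_upd (dom_lmul_phi2 (six a b c s) a b c) i _
    _ = _ := by simp; ring

/-- Coordinatewise alignment. -/
noncomputable def AL (a b : Fin k) (θ σ : Profile n k) : Profile n k := fun l => al a b (θ l) (σ l)

noncomputable def ALequiv {a b : Fin k} (hab : a ≠ b) :
    Profile n k × Profile n k ≃ Profile n k × Profile n k where
  toFun x := (AL a b x.1 x.2, AL a b x.2 x.1)
  invFun x := (AL a b x.1 x.2, AL a b x.2 x.1)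
  left_inv x := by
    ext1 <;> funext l <;> exact al_al hab _ _
  right_inv x := by
    ext1 <;> funext l <;> exact al_al hab _ _

lemma dom_AL {a b : Fin k} (hab : a ≠ b) :
    Dom 1 (fun x : Profile n k × Profile n k => AL a b x.1 x.2) := by
  intro p
  have := dom_fst (Ω := Profile n k) (Ω' := Profile n k) p
  have e := prob_equiv (ALequiv (n := n) hab) (fun x => p x.1)
  rw [← e] at this
  exact this

lemma prob_AL {a b : Fin k} (hab : a ≠ b) (p : Profile n k → Prop) :
    prob (fun x : Profile n k × Profile n k => p (AL a b x.1 x.2)) = prob p := by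
  have := prob_fst (Ω := Profile n k) (Ω' := Profile n k) p
  rw [← this]
  exact prob_equiv (ALequiv (n := n) hab) (fun x => p x.1)

def mvEquiv (l : Fin n) (r : ℕ) : Profile n k ≃ Profile n k := Equiv.mulRight (Pi.mulSingle l (sw k r))

lemma dom_mv (l : Fin n) (r : ℕ) : Dom 1 (mv (k := k) l r) := by
  have := dom_equiv (mvEquiv (k := k) l r)
  intro p
  simp_rw [mv_eq]
  exact this p

lemma estep (f : Profile n k → Fin k) {a b : Fin k} (hab : a ≠ b) (i l : Fin n) (r : ℕ) (t : ℝ)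
    (ht0 : 0 ≤ t) (ht : l = i → ∀ c, c ≠ a → c ≠ b → prob (TT f i a b c) ≤ t) :
    prob (fun x : Profile n k × Profile n k =>
      EE f i a b (AL a b x.1 x.2) ≠ EE f i a b (AL a b x.1 (mv l r x.2))) ≤
      12 * (k : ℝ) ^ 2 * mm f + (if l = i then 2 * k * t else 0) := by
  set W : Profile n k → Prop := fun x => BadE f i a b x ∨ ∃ c ∈ (univ : Finset (Fin k)),
    (l = i ∧ c ≠ a ∧ c ≠ b ∧ TT f i a b c x) with hW
  have hWp : prob W ≤ 6 * (k : ℝ) ^ 2 * mm f + (if l = i then k * t else 0) := by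
    refine (prob_or _ _).trans (add_le_add (prob_BadE f i a b) ?_)
    refine (prob_exists _ _).trans ?_
    split_ifs with h
    · calc _ ≤ ∑ c : Fin k, t := Finset.sum_le_sum fun c _ => by
            by_cases hc : c ≠ a ∧ c ≠ b
            · exact (prob_mono (fun ω hω => hω.2.2.2)).trans (ht h c hc.1 hc.2)
            · rw [prob_false]
              · exact ht0
              · intro ω hω
                exact hc ⟨hω.2.1, hω.2.2.1⟩
        _ = k * t := by simp
    · rw [Finset.sum_eq_zero]
      intro c _
      exact prob_false (fun ω hω => h hω.1)
  have h1 : prob (fun x : Profile n k × Profile n k => W (AL a b x.1 x.2)) ≤ prob W := by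
    simpa using dom_AL hab W
  have h2 : prob (fun x : Profile n k × Profile n k => W (AL a b x.1 (mv l r x.2))) ≤ prob W := by
    have := (dom_AL (n := n) hab).comp zero_le_one ((dom_mv (k := k) l r).prodMap_right (Ω₂ := Profile n k)) W
    simpa using this
  have h3 : prob (fun x : Profile n k × Profile n k =>
      EE f i a b (AL a b x.1 x.2) ≠ EE f i a b (AL a b x.1 (mv l r x.2))) ≤ prob W + prob W := by
    refine le_trans (prob_mono ?_) ((prob_or _ _).trans (add_le_add h1 h2))
    rintro ⟨θ, σ⟩ hne
    dsimp only at hne ⊢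
    by_contra hcon
    rw [not_or] at hcon
    apply hne
    have e : AL a b θ (mv l r σ) = update (AL a b θ σ) l (al a b (θ l) (σ l * sw k r)) := by
      funext j
      by_cases hj : j = l
      · subst hj; simp [AL, mv]
      · simp [AL, mv, hj]
    rcases sw_edge (σ l) r with h | ⟨u, v, h⟩
    · rw [e, h]
      congr 1
      exact (Function.update_eq_self l (AL a b θ σ)).symm
    · rcases h.al_edge hab (θ l) with h | ⟨u', v', h, g1, g2⟩
      · rw [e, ← h]
        congr 1
        exact (Function.update_eq_self l (AL a b θ σ)).symm
      · rw [e] at hcon ⊢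
        apply propext
        refine E_lem hab (u := u') (v := v') h g1 g2 (fun hb => hcon.1 (Or.inl hb))
          (fun hb => hcon.2 (Or.inl hb)) ?_
        intro hl c hc1 hc2
        exact ⟨fun hT => hcon.1 (Or.inr ⟨c, mem_univ _, hl, hc1, hc2, hT⟩),
          fun hT => hcon.2 (Or.inr ⟨c, mem_univ _, hl, hc1, hc2, hT⟩)⟩
  refine h3.trans ?_
  split_ifs at hWp ⊢ <;> linarith

lemma einv_gen (f : Profile n k → Fin k) {a b : Fin k} (hab : a ≠ b) (i : Fin n)
    (L : Finset (Fin n)) :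
    prob (fun x : Profile n k × Profile n k =>
      EE f i a b x.1 ≠ EE f i a b (mix L x.1 (AL a b x.1 x.2))) ≤
    k * ∑ l ∈ L, ∑ r ∈ Finset.range k, prob (fun x : Profile n k × Profile n k =>
      EE f i a b (AL a b x.1 x.2) ≠ EE f i a b (AL a b x.1 (mv l r x.2))) := by
  refine le_trans (le_of_eq ?_) (poincare (fun θ σ => EE f i a b (AL a b θ σ)) L)
  set q : Profile n k × Profile n k → Prop := fun x =>
      EE f i a b x.1 ≠ EE f i a b (mix L x.1 (AL a b x.1 x.2)) with hq
  let e : (Profile n k × Profile n k) × Profile n k ≃ (Profile n k × Profile n k) × Profile n k :=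
    { toFun := fun x => ((x.1.1, x.2), x.1.2)
      invFun := fun x => ((x.1.1, x.2), x.1.2)
      left_inv := fun x => rfl
      right_inv := fun x => rfl }
  have h1 : prob q = prob (fun x : (Profile n k × Profile n k) × Profile n k => q x.1) :=
    (prob_fst q).symm
  have h2 := prob_equiv e (fun x : (Profile n k × Profile n k) × Profile n k => q x.1)
  have h3 := prob_equiv (Equiv.prodCongr (ALequiv (n := n) hab) (Equiv.refl (Profile n k)))
    (fun x : (Profile n k × Profile n k) × Profile n k => q (e x).1)
  rw [h1, ← h2, ← h3]
  apply prob_congr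
  rintro ⟨⟨θ, σ⟩, ρ⟩
  have e1 : AL a b θ (mix L σ ρ) = mix L (AL a b θ σ) (AL a b (AL a b θ σ) ρ) := by
    funext l
    by_cases hl : l ∈ L
    · simp only [AL, mix, hl, if_true]
      exact al_congr (al_bit hab _ _).symm _
    · simp [AL, mix, hl]
  simp only [hq, e, ALequiv, Equiv.prodCongr_apply, Equiv.coe_fn_mk, Prod.map]
  rw [e1]
  exact Iff.rfl

lemma einv_all (f : Profile n k → Fin k) {a b : Fin k} (hab : a ≠ b) (i : Fin n) (t : ℝ)
    (ht0 : 0 ≤ t) (ht : ∀ c, c ≠ a → c ≠ b → prob (TT f i a b c) ≤ t) :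
    prob (fun x : Profile n k × Profile n k =>
      EE f i a b x.1 ≠ EE f i a b (AL a b x.1 x.2)) ≤
      12 * n * (k : ℝ) ^ 4 * mm f + 2 * (k : ℝ) ^ 3 * t := by
  have h := einv_gen f hab i univ
  have e : ∀ x y : Profile n k, mix univ x y = y := fun x y => by funext l; simp [mix]
  simp only [e] at h
  refine h.trans ?_
  calc _ ≤ (k : ℝ) * ∑ l : Fin n, ∑ r ∈ Finset.range k,
          (12 * (k : ℝ) ^ 2 * mm f + (if l = i then 2 * k * t else 0)) := by
        gcongr with l _ r _
        exact estep f hab i l r t ht0 (fun _ => ht)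
    _ = _ := by
        simp [Finset.sum_add_distrib]
        ring

lemma einv_one (f : Profile n k → Fin k) {a b : Fin k} (hab : a ≠ b) (i l : Fin n) (hl : l ≠ i) :
    prob (fun x : Profile n k × Profile n k =>
      EE f i a b x.1 ≠ EE f i a b (update x.1 l (al a b (x.1 l) (x.2 l)))) ≤
      12 * (k : ℝ) ^ 4 * mm f := by
  have h := einv_gen f hab i {l}
  have e : ∀ x y : Profile n k, mix {l} x y = update x l (y l) := fun x y => by
    funext j
    by_cases hj : j = l
    · subst hj; simp [mix]
    · simp [mix, hj]
  simp only [e] at h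
  refine h.trans ?_
  calc _ ≤ (k : ℝ) * ∑ l ∈ ({l} : Finset (Fin n)), ∑ r ∈ Finset.range k,
          (12 * (k : ℝ) ^ 2 * mm f) := by
        gcongr with l' hl' r _
        rw [Finset.mem_singleton] at hl'
        have := estep f hab i l' r 0 le_rfl (fun hh => absurd (hl' ▸ hh) hl)
        simpa using this
    _ = _ := by
        simp
        ring

lemma tinv (f : Profile n k → Fin k) {a b c : Fin k} (hab : a ≠ b) (hac : a ≠ c) (hbc : b ≠ c)
    (i : Fin n) :
    prob (fun x : Profile n k × Profile n k =>
      TT f i a b c x.1 ≠ TT f i a b c (mix {i}ᶜ x.1 x.2)) ≤ 12 * n * (k : ℝ) ^ 4 * mm f := by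
  have h := poincare (Θ := Unit) (fun _ => TT f i a b c) {i}ᶜ
  have e : prob (fun x : (Unit × Profile n k) × Profile n k =>
      TT f i a b c x.1.2 ≠ TT f i a b c (mix {i}ᶜ x.1.2 x.2)) =
      prob (fun x : Profile n k × Profile n k =>
      TT f i a b c x.1 ≠ TT f i a b c (mix {i}ᶜ x.1 x.2)) :=
    prob_equiv (Equiv.prodCongr (Equiv.punitProd _) (Equiv.refl _))
      (fun x : Profile n k × Profile n k =>
      TT f i a b c x.1 ≠ TT f i a b c (mix {i}ᶜ x.1 x.2))
  rw [← e]
  refine h.trans ?_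
  have hstep : ∀ l ∈ ({i}ᶜ : Finset (Fin n)), ∀ r, prob (fun x : Unit × Profile n k =>
      TT f i a b c x.2 ≠ TT f i a b c (mv l r x.2)) ≤ 12 * (k : ℝ) ^ 2 * mm f := by
    intro l hl r
    have hl' : l ≠ i := by simpa using hl
    have h1 : prob (fun x : Unit × Profile n k => BadT f i a b c x.2) ≤ 6 * (k : ℝ) ^ 2 * mm f := by
      rw [prob_snd (Ω := Unit) (BadT f i a b c)]
      exact prob_BadT f i a b c
    have h2 : prob (fun x : Unit × Profile n k => BadT f i a b c (mv l r x.2)) ≤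
        6 * (k : ℝ) ^ 2 * mm f := by
      rw [prob_snd (Ω := Unit) (fun σ => BadT f i a b c (mv l r σ))]
      have := dom_mv (k := k) l r (BadT f i a b c)
      rw [one_mul] at this
      exact this.trans (prob_BadT f i a b c)
    refine le_trans (prob_mono ?_) ((prob_or _ _).trans ((add_le_add h1 h2).trans (by linarith)))
    rintro ⟨_, σ⟩ hne
    dsimp only at hne ⊢
    by_contra hcon
    rw [not_or] at hcon
    apply hne
    rcases sw_edge (σ l) r with h | ⟨u, v, h⟩
    · unfold mv
      rw [h, Function.update_eq_self]
    · exact propext (T_lem hab hac hbc hl' h hcon.1 hcon.2)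
  calc _ ≤ (k : ℝ) * ∑ l ∈ ({i}ᶜ : Finset (Fin n)), ∑ r ∈ Finset.range k,
          (12 * (k : ℝ) ^ 2 * mm f) := by
        gcongr with l hl r _
        exact hstep l hl r
    _ ≤ (k : ℝ) * ∑ l : Fin n, ∑ r ∈ Finset.range k, (12 * (k : ℝ) ^ 2 * mm f) := by
        have := mm_nonneg f
        gcongr
        exact Finset.subset_univ _
    _ = _ := by
        simp
        ring

end Inv
end QGS

namespace QGS

/-! ## A two-function reverse hypercontractive type bound -/

section RHC

variable {k : ℕ}

lemma prob_relabel (π : Equiv.Perm (Fin k)) (p : Equiv.Perm (Fin k) → Prop) :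
    prob (fun τ => p (π * τ)) = prob p := prob_equiv (Equiv.mulLeft π) p

lemma prob_true {Ω : Type*} [Fintype Ω] [Nonempty Ω] {p : Ω → Prop} (h : ∀ ω, p ω) : prob p = 1 := by
  classical
  rw [prob_eq]
  simp only [h, if_true]
  exact ex_const 1

lemma prob_split {Ω : Type*} [Fintype Ω] (p q : Ω → Prop) :
    prob (fun ω => p ω ∧ q ω) + prob (fun ω => p ω ∧ ¬ q ω) = prob p := by
  classical
  rw [prob_eq, prob_eq, prob_eq, ← ex_add]
  congr 1
  funext ω
  by_cases h1 : p ω <;> by_cases h2 : q ω <;> simp [h1, h2]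

lemma not_above {a b : Fin k} (hab : a ≠ b) (τ : Equiv.Perm (Fin k)) :
    ¬ Above τ a b ↔ Above τ b a := by
  have := above_total τ hab
  have := @above_asymm _ τ a b
  tauto

lemma prob_above {a b : Fin k} (hab : a ≠ b) :
    prob (fun τ : Equiv.Perm (Fin k) => Above τ a b) = 1 / 2 := by
  have h1 := prob_relabel (Equiv.swap a b) (fun τ => Above τ a b)
  simp only [above_swap_self] at h1
  have h2 := prob_split (fun _ : Equiv.Perm (Fin k) => True) (fun τ => Above τ a b)
  rw [prob_true (fun _ => trivial)] at h2
  simp only [true_and, not_above hab] at h2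
  linarith

lemma q_relabel (π : Equiv.Perm (Fin k)) (x y z : Fin k) :
    prob (fun τ => Above τ (π x) (π y) ∧ Above τ (π y) (π z)) =
      prob (fun τ => Above τ x y ∧ Above τ y z) := by
  rw [← prob_relabel π]
  apply prob_congr
  intro τ
  simp [above_mul]

lemma prob_three {x y z : Fin k} (hxy : x ≠ y) (hxz : x ≠ z) (hyz : y ≠ z) :
    1 / 6 ≤ prob (fun τ : Equiv.Perm (Fin k) => Above τ x y ∧ Above τ y z) := by
  set q : Fin k → Fin k → Fin k → ℝ := fun x y z =>
    prob (fun τ : Equiv.Perm (Fin k) => Above τ x y ∧ Above τ y z) with hq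
  have s1 : ∀ x y z : Fin k, x ≠ y → x ≠ z → y ≠ z → q y x z = q x y z := by
    intro x y z hxy hxz hyz
    have := q_relabel (Equiv.swap x y) x y z
    rwa [Equiv.swap_apply_left, Equiv.swap_apply_right,
      Equiv.swap_apply_of_ne_of_ne hxz.symm hyz.symm] at this
  have s2 : ∀ x y z : Fin k, x ≠ y → x ≠ z → y ≠ z → q x z y = q x y z := by
    intro x y z hxy hxz hyz
    have := q_relabel (Equiv.swap y z) x y z
    rwa [Equiv.swap_apply_left, Equiv.swap_apply_right,
      Equiv.swap_apply_of_ne_of_ne hxy hxz] at this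
  have cover : 1 ≤ q x y z + (q x z y + (q y x z + (q y z x + (q z x y + q z y x)))) := by
    rw [← prob_true (Ω := Equiv.Perm (Fin k)) (fun _ => trivial)]
    refine le_trans (prob_mono ?_) ((prob_or _ _).trans (add_le_add le_rfl ((prob_or _ _).trans
      (add_le_add le_rfl ((prob_or _ _).trans (add_le_add le_rfl ((prob_or _ _).trans
      (add_le_add le_rfl (prob_or _ _)))))))))
    intro τ _
    have := above_total τ hxy
    have := above_total τ hxz
    have := above_total τ hyz
    tauto
  have e1 := s1 x y z hxy hxz hyz
  have e2 := s2 x y z hxy hxz hyz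
  have e3 := s2 y x z hxy.symm hyz hxz
  have e4 := s1 x z y hxz hxy hyz.symm
  have e5 := s2 z x y hxz.symm hyz.symm hxy
  show 1 / 6 ≤ q x y z
  linarith

lemma prob_two_pairs {a b c d : Fin k} (hab : a ≠ b) (hcd : c ≠ d) (h1 : ¬ (a = c ∧ b = d))
    (h2 : ¬ (a = d ∧ b = c)) :
    1 / 6 ≤ prob (fun τ : Equiv.Perm (Fin k) => Above τ a b ∧ Above τ c d) := by
  by_cases hbc : b = c
  · subst hbc
    exact prob_three hab (fun h => h2 ⟨h, rfl⟩) hcd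
  by_cases had : a = d
  · subst had
    refine (prob_three hcd (fun h => hbc h.symm) hab).trans (prob_mono fun τ h => ⟨h.2, h.1⟩)
  by_cases hac : a = c
  · subst hac
    refine (prob_three hab hcd (fun h => h1 ⟨rfl, h⟩)).trans
      (prob_mono fun τ h => ⟨h.1, above_trans h.1 h.2⟩)
  by_cases hbd : b = d
  · subst hbd
    refine (prob_three hac hab hcd).trans
      (prob_mono fun τ h => ⟨above_trans h.1 h.2, h.2⟩)
  have e1 : ∀ u v : Fin k, u ≠ a → u ≠ b → v ≠ a → v ≠ b →
      prob (fun τ : Equiv.Perm (Fin k) => Above τ b a ∧ Above τ u v) =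
      prob (fun τ : Equiv.Perm (Fin k) => Above τ a b ∧ Above τ u v) := by
    intro u v hu hu' hv hv'
    rw [← prob_relabel (Equiv.swap a b)]
    apply prob_congr
    intro τ
    rw [above_swap, above_swap, Equiv.swap_apply_left, Equiv.swap_apply_right,
      Equiv.swap_apply_of_ne_of_ne hu hu', Equiv.swap_apply_of_ne_of_ne hv hv']
  have e2 := prob_split (fun τ : Equiv.Perm (Fin k) => Above τ c d) (fun τ => Above τ a b)
  simp only [not_above hab, prob_above hcd] at e2
  have e3 := e1 c d (fun h => hac h.symm) (fun h => hbc h.symm) (fun h => had h.symm)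
    (fun h => hbd h.symm)
  have e4 : ∀ u v : Fin k, prob (fun τ : Equiv.Perm (Fin k) => Above τ c d ∧ Above τ u v) =
      prob (fun τ : Equiv.Perm (Fin k) => Above τ u v ∧ Above τ c d) :=
    fun u v => prob_congr fun τ => and_comm
  rw [e4, e4] at e2
  linarith

lemma two_point_ineq (A B C D p00 p01 p10 p11 : ℝ)
    (h1 : p11 + p10 = 1 / 2) (h2 : p11 + p01 = 1 / 2)
    (h3 : p01 + p00 = 1 / 2) (q1 : 1 / 6 ≤ p11) (q2 : 1 / 6 ≤ p10) :
    ((A + B) / 2) ^ 2 * ((C + D) / 2) ^ 2 ≤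
      A ^ 2 * C ^ 2 * p11 + A ^ 2 * D ^ 2 * p10 + (B ^ 2 * C ^ 2 * p01 + B ^ 2 * D ^ 2 * p00) := by
  have e1 : p10 = 1 / 2 - p11 := by linarith
  have e2 : p01 = 1 / 2 - p11 := by linarith
  have e3 : p00 = p11 := by linarith
  subst e1 e2 e3
  have key : A ^ 2 * C ^ 2 * p00 + A ^ 2 * D ^ 2 * (1 / 2 - p00) + (B ^ 2 * C ^ 2 * (1 / 2 - p00) +
      B ^ 2 * D ^ 2 * p00) - ((A + B) / 2) ^ 2 * ((C + D) / 2) ^ 2 =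
      (1 / 16) * ((A - B) ^ 2 * (C - D) ^ 2 +
        (1 + 2 * (4 * p00 - 1)) / 2 * ((A + B) * (C - D) + (A - B) * (C + D)) ^ 2 +
        (1 - 2 * (4 * p00 - 1)) / 2 * ((A + B) * (C - D) - (A - B) * (C + D)) ^ 2) := by ring
  have k1 : 0 ≤ (1 + 2 * (4 * p00 - 1)) / 2 := by linarith
  have k2 : 0 ≤ (1 - 2 * (4 * p00 - 1)) / 2 := by linarith
  have : 0 ≤ (1 / 16) * ((A - B) ^ 2 * (C - D) ^ 2 +
        (1 + 2 * (4 * p00 - 1)) / 2 * ((A + B) * (C - D) + (A - B) * (C + D)) ^ 2 +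
        (1 - 2 * (4 * p00 - 1)) / 2 * ((A + B) * (C - D) - (A - B) * (C + D)) ^ 2) := by
    positivity
  linarith

open Classical in
lemma bit_form {X : Type*} (P : X → Prop) (α : X → ℝ) (h : ∀ x y, (P x ↔ P y) → α x = α y) :
    ∃ A B : ℝ, ∀ x, α x = if P x then A else B := by
  have key : ∀ Q : X → Prop, (∀ x y, Q x → Q y → (P x ↔ P y)) → ∃ A : ℝ, ∀ x, Q x → α x = A := by
    intro Q hQ
    by_cases hx : ∃ x, Q x
    · obtain ⟨x, hx⟩ := hx
      exact ⟨α x, fun y hy => h y x (hQ y x hy hx)⟩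
    · exact ⟨0, fun y hy => absurd ⟨y, hy⟩ hx⟩
  obtain ⟨A, hA⟩ := key P (by tauto)
  obtain ⟨B, hB⟩ := key (fun x => ¬ P x) (by tauto)
  refine ⟨A, B, fun x => ?_⟩
  split_ifs with hx
  · exact hA x hx
  · exact hB x hx

lemma prob_eq' {X : Type*} [Fintype X] (p : X → Prop) [DecidablePred p] :
    ex (fun ω => if p ω then (1 : ℝ) else 0) = prob p := by
  rw [prob_eq]
  congr 1
  funext x
  congr

lemma one_coord {a b c d : Fin k} (hab : a ≠ b) (hcd : c ≠ d) (h1 : ¬ (a = c ∧ b = d))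
    (h2 : ¬ (a = d ∧ b = c)) (α β : Equiv.Perm (Fin k) → ℝ)
    (hα : ∀ x y, (Above x a b ↔ Above y a b) → α x = α y)
    (hβ : ∀ x y, (Above x c d ↔ Above y c d) → β x = β y) :
    (ex α) ^ 2 * (ex β) ^ 2 ≤ ex (fun x => α x ^ 2 * β x ^ 2) := by
  classical
  obtain ⟨A, B, hA⟩ := bit_form _ α hα
  obtain ⟨C, D, hC⟩ := bit_form _ β hβ
  have half : ∀ (u v : Fin k) (huv : u ≠ v) (A B : ℝ), ex (fun x : Equiv.Perm (Fin k) =>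
      if Above x u v then A else B) = (A + B) / 2 := by
    intro u v huv A B
    have e : (fun x : Equiv.Perm (Fin k) => if Above x u v then A else B) = fun x =>
        A * (if Above x u v then (1 : ℝ) else 0) + B * (if Above x v u then (1 : ℝ) else 0) := by
      funext x
      by_cases h : Above x u v
      · simp [h, above_asymm h]
      · simp [h, (not_above huv x).1 h]
    rw [e, ex_add, ex_mul_left, ex_mul_left, prob_eq', prob_eq', prob_above huv,
      prob_above huv.symm]
    ring
  have e1 : ex α = (A + B) / 2 := by rw [funext hA]; exact half a b hab A B
  have e2 : ex β = (C + D) / 2 := by rw [funext hC]; exact half c d hcd C D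
  have e3 : (fun x => α x ^ 2 * β x ^ 2) = fun x =>
      (A ^ 2 * C ^ 2 * (if Above x a b ∧ Above x c d then (1 : ℝ) else 0) +
      A ^ 2 * D ^ 2 * (if Above x a b ∧ ¬ Above x c d then (1 : ℝ) else 0)) +
      (B ^ 2 * C ^ 2 * (if ¬ Above x a b ∧ Above x c d then (1 : ℝ) else 0) +
      B ^ 2 * D ^ 2 * (if ¬ Above x a b ∧ ¬ Above x c d then (1 : ℝ) else 0)) := by
    funext x
    rw [hA, hC]
    by_cases h : Above x a b <;> by_cases h' : Above x c d <;> simp [h, h']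
  rw [e1, e2, e3, ex_add, ex_add, ex_add, ex_mul_left, ex_mul_left, ex_mul_left, ex_mul_left,
    prob_eq', prob_eq', prob_eq', prob_eq']
  apply two_point_ineq
  · rw [prob_split, prob_above hab]
  · have := prob_split (fun τ : Equiv.Perm (Fin k) => Above τ c d) (fun τ => Above τ a b)
    rw [prob_above hcd] at this
    rw [← this]
    congr 1 <;> exact prob_congr fun τ => and_comm
  · have := prob_split (fun τ : Equiv.Perm (Fin k) => ¬ Above τ a b) (fun τ => Above τ c d)
    rw [this]
    simp only [not_above hab]
    exact prob_above hab.symm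
  · exact prob_two_pairs hab hcd h1 h2
  · simp only [not_above hcd]
    exact prob_two_pairs hab hcd.symm h2 h1

lemma rhc_gen {X : Type*} [Fintype X] [Nonempty X] (P Q : X → Prop)
    (hX : ∀ α β : X → ℝ, (∀ x y, (P x ↔ P y) → α x = α y) → (∀ x y, (Q x ↔ Q y) → β x = β y) →
      (ex α) ^ 2 * (ex β) ^ 2 ≤ ex (fun x => α x ^ 2 * β x ^ 2)) (n : ℕ) :
    ∀ F G : (Fin n → X) → ℝ, (∀ σ, 0 ≤ F σ) → (∀ σ, F σ ≤ 1) → (∀ σ, 0 ≤ G σ) → (∀ σ, G σ ≤ 1) →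
      (∀ σ σ', (∀ l, P (σ l) ↔ P (σ' l)) → F σ = F σ') →
      (∀ σ σ', (∀ l, Q (σ l) ↔ Q (σ' l)) → G σ = G σ') →
      (ex F) ^ 2 * (ex G) ^ 2 ≤ ex (fun σ => F σ * G σ) := by
  induction n with
  | zero =>
    intro F G hF0 hF1 hG0 hG1 _ _
    have e : ∀ H : (Fin 0 → X) → ℝ, ex H = H Fin.elim0 := by
      intro H
      have : H = fun _ => H Fin.elim0 := by
        funext σ
        congr 1
        exact Subsingleton.elim _ _
      rw [this]
      exact ex_const _
    rw [e, e, e]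
    have a0 := hF0 Fin.elim0
    have a1 := hF1 Fin.elim0
    have b0 := hG0 Fin.elim0
    have b1 := hG1 Fin.elim0
    have c1 : F Fin.elim0 ^ 2 ≤ F Fin.elim0 := by nlinarith
    have c2 : G Fin.elim0 ^ 2 ≤ G Fin.elim0 := by nlinarith
    exact mul_le_mul c1 c2 (sq_nonneg _) a0
  | succ n ih =>
    intro F G hF0 hF1 hG0 hG1 hF hG
    let e : X × (Fin n → X) ≃ (Fin (n + 1) → X) := Fin.consEquiv (fun _ => X)
    have ee : ∀ H : (Fin (n + 1) → X) → ℝ, ex H =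
        ex (fun x => ex (fun σ : Fin n → X => H (Fin.cons x σ))) := by
      intro H
      rw [← ex_equiv e, ex_prod]
      rfl
    rw [ee F, ee G, ee]
    refine le_trans (hX _ _ ?_ ?_) (ex_mono fun x => ih _ _ ?_ ?_ ?_ ?_ ?_ ?_)
    · intro x y h
      congr 1
      funext σ
      apply hF
      intro l
      refine Fin.cases ?_ (fun l => ?_) l
      · simpa using h
      · simp
    · intro x y h
      congr 1
      funext σ
      apply hG
      intro l
      refine Fin.cases ?_ (fun l => ?_) l
      · simpa using h
      · simp
    · exact fun σ => hF0 _
    · exact fun σ => hF1 _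
    · exact fun σ => hG0 _
    · exact fun σ => hG1 _
    · intro σ σ' h
      apply hF
      intro l
      refine Fin.cases ?_ (fun l => ?_) l
      · simp
      · simpa using h l
    · intro σ σ' h
      apply hG
      intro l
      refine Fin.cases ?_ (fun l => ?_) l
      · simp
      · simpa using h l

lemma rhc {n : ℕ} {a b c d : Fin k} (hab : a ≠ b) (hcd : c ≠ d) (h1 : ¬ (a = c ∧ b = d))
    (h2 : ¬ (a = d ∧ b = c)) (F G : Profile n k → ℝ) (hF0 : ∀ σ, 0 ≤ F σ) (hF1 : ∀ σ, F σ ≤ 1)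
    (hG0 : ∀ σ, 0 ≤ G σ) (hG1 : ∀ σ, G σ ≤ 1)
    (hF : ∀ σ σ', (∀ l, Above (σ l) a b ↔ Above (σ' l) a b) → F σ = F σ')
    (hG : ∀ σ σ', (∀ l, Above (σ l) c d ↔ Above (σ' l) c d) → G σ = G σ') :
    (ex F) ^ 2 * (ex G) ^ 2 ≤ ex (fun σ => F σ * G σ) :=
  rhc_gen (fun x => Above x a b) (fun x => Above x c d)
    (fun α β => one_coord hab hcd h1 h2 α β) n F G hF0 hF1 hG0 hG1 hF hG

end RHC
end QGS

namespace QGS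

/-! ## Intersection of two influences -/

section Inter

variable {n k : ℕ}

open Function (update)

lemma EE_symm (f : Profile n k → Fin k) (i : Fin n) (a b : Fin k) (σ : Profile n k) :
    EE f i b a (update σ i (Equiv.swap a b * σ i)) ↔ EE f i a b σ := by
  unfold EE
  rw [Function.update_idem, Function.update_idem, Function.update_self, phi_relabel_swap,
    Equiv.swap_comm b a, ← mul_assoc, Equiv.swap_mul_self, one_mul]
  exact and_comm

lemma dom_swap (i : Fin n) (a b : Fin k) :
    Dom 1 (fun σ : Profile n k => update σ i (Equiv.swap a b * σ i)) :=
  dom_upd (dom_lmul (Equiv.swap a b)) i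

lemma prob_EE_symm_le (f : Profile n k → Fin k) (i : Fin n) (a b : Fin k) :
    prob (EE f i a b) ≤ prob (EE f i b a) := by
  have := dom_swap i a b (EE f i b a)
  rw [one_mul] at this
  refine le_trans (le_of_eq (prob_congr fun σ => ?_)) this
  exact (EE_symm f i a b σ).symm

lemma prob_EE_symm (f : Profile n k → Fin k) (i : Fin n) (a b : Fin k) :
    prob (EE f i a b) = prob (EE f i b a) :=
  le_antisymm (prob_EE_symm_le f i a b) (prob_EE_symm_le f i b a)

lemma cross_lem (f : Profile n k → Fin k) {i j : Fin n} (hij : i ≠ j) {a b c d : Fin k}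
    (hab : a ≠ b) (hcd : c ≠ d) (hda : d ≠ a) (hdb : d ≠ b) (σ : Profile n k)
    (h1 : EE f i a b (update σ j (phi c d (σ j)))) (h2 : EE f j c d (update σ i (phi a b (σ i)))) :
    ∃ u ∈ (univ : Finset (Fin 2)), ∃ v ∈ (univ : Finset (Fin 2)), IsManipPointR 4 f
      (update (update σ j ((![1, Equiv.swap c d] : Fin 2 → Equiv.Perm (Fin k)) v * phi c d (σ j))) i
        ((![1, Equiv.swap a b] : Fin 2 → Equiv.Perm (Fin k)) u * phi a b (σ i))) := by
  by_contra hM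
  push Not at hM
  have m00 := hM 0 (mem_univ _) 0 (mem_univ _)
  have m01 := hM 0 (mem_univ _) 1 (mem_univ _)
  have m10 := hM 1 (mem_univ _) 0 (mem_univ _)
  have m11 := hM 1 (mem_univ _) 1 (mem_univ _)
  simp only [Matrix.cons_val_zero, Matrix.cons_val_one, one_mul] at m00 m01 m10 m11
  unfold EE at h1 h2
  rw [Function.update_of_ne hij] at h1
  rw [Function.update_of_ne hij.symm] at h2
  rw [Function.update_comm hij, Function.update_comm hij] at h2
  obtain ⟨p1, p2⟩ := h1
  obtain ⟨p3, p4⟩ := h2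
  have hac : a = c := p1.symm.trans p3
  subst hac
  have q1 := edge_lem (phi_edge a b hab (σ i)) m01 m11
  rw [p4] at q1
  rcases q1 with q1 | q1
  · rw [Function.update_comm hij.symm] at m10 m11 p2
    rw [Function.update_comm hij.symm] at q1
    have q2 := edge_lem (phi_edge a d hcd (σ j)) m10 m11
    rw [p2, ← q1] at q2
    rcases q2 with q2 | q2
    · exact hdb q2.symm
    · exact hab q2.1.symm
  · exact hda q1.1

lemma prob_cross (f : Profile n k → Fin k) {i j : Fin n} (hij : i ≠ j) {a b c d : Fin k}
    (hab : a ≠ b) (hcd : c ≠ d) (hda : d ≠ a) (hdb : d ≠ b) :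
    prob (fun σ : Profile n k => EE f i a b (update σ j (phi c d (σ j))) ∧
      EE f j c d (update σ i (phi a b (σ i)))) ≤ 4 * (k : ℝ) ^ 2 * mm f := by
  have dd : ∀ π π' : Equiv.Perm (Fin k), prob (fun σ : Profile n k => IsManipPointR 4 f
      (update (update σ j (π * phi c d (σ j))) i (π' * phi a b (σ i)))) ≤ (k : ℝ) ^ 2 * mm f := by
    intro π π'
    have := (dom_upd (dom_lmul_phi π' a b) i).comp (by positivity)
      (dom_upd (n := n) (dom_lmul_phi π c d) j)
    have := this (IsManipPointR 4 f)
    rw [← sq] at this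
    refine le_trans (le_of_eq (prob_congr fun σ => ?_)) this
    beta_reduce
    rw [Function.update_of_ne hij]
  calc _ ≤ prob (fun σ : Profile n k => ∃ u ∈ (univ : Finset (Fin 2)),
        ∃ v ∈ (univ : Finset (Fin 2)), IsManipPointR 4 f
        (update (update σ j ((![1, Equiv.swap c d] : Fin 2 → Equiv.Perm (Fin k)) v * phi c d (σ j))) i
        ((![1, Equiv.swap a b] : Fin 2 → Equiv.Perm (Fin k)) u * phi a b (σ i)))) :=
        prob_mono fun σ h => cross_lem f hij hab hcd hda hdb σ h.1 h.2
    _ ≤ ∑ u : Fin 2, prob (fun σ : Profile n k => ∃ v ∈ (univ : Finset (Fin 2)), IsManipPointR 4 f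
        (update (update σ j ((![1, Equiv.swap c d] : Fin 2 → Equiv.Perm (Fin k)) v * phi c d (σ j))) i
        ((![1, Equiv.swap a b] : Fin 2 → Equiv.Perm (Fin k)) u * phi a b (σ i)))) := prob_exists _ _
    _ ≤ ∑ u : Fin 2, ∑ v : Fin 2, (k : ℝ) ^ 2 * mm f :=
        Finset.sum_le_sum fun u _ => le_trans (prob_exists _ _)
          (Finset.sum_le_sum fun v _ => dd _ _)
    _ = _ := by
        simp only [Finset.sum_const, Finset.card_univ, Fintype.card_fin, nsmul_eq_mul]
        push_cast
        ring

lemma inter_aux (f : Profile n k → Fin k) {i j : Fin n} (hij : i ≠ j) {a b c d : Fin k}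
    (hab : a ≠ b) (hcd : c ≠ d) (hda : d ≠ a) (hdb : d ≠ b) (hbc : b ≠ c) (t : ℝ) (ht0 : 0 ≤ t)
    (ht : ∀ e, e ≠ a → e ≠ b → prob (TT f i a b e) ≤ t)
    (ht' : ∀ e, e ≠ c → e ≠ d → prob (TT f j c d e) ≤ t) :
    prob (EE f i a b) ^ 2 * prob (EE f j c d) ^ 2 ≤
      2 * (k * (12 * n * (k : ℝ) ^ 4 * mm f + 2 * (k : ℝ) ^ 3 * t)) + 4 * (k : ℝ) ^ 2 * mm f := by
  have hbd : b ≠ d := hdb.symm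
  set F : Profile n k → ℝ := fun σ => prob (fun ρ : Profile n k => EE f i a b (AL a b σ ρ)) with hF
  set G : Profile n k → ℝ := fun σ => prob (fun ρ : Profile n k => EE f j c d (AL c d σ ρ)) with hG
  have eF : ex F = prob (EE f i a b) := by
    rw [← prob_AL hab (EE f i a b), prob_prod]
  have eG : ex G = prob (EE f j c d) := by
    rw [← prob_AL hcd (EE f j c d), prob_prod]
  have ALc : ∀ (u v : Fin k) (σ σ' : Profile n k), (∀ l, Above (σ l) u v ↔ Above (σ' l) u v) →
      ∀ ρ, AL u v σ ρ = AL u v σ' ρ := by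
    intro u v σ σ' h ρ
    funext l
    exact al_congr (h l) _
  have R := rhc hab hcd (fun h => hbd h.2) (fun h => hda h.1.symm) F G (fun σ => prob_nonneg _)
    (fun σ => prob_le_one _) (fun σ => prob_nonneg _) (fun σ => prob_le_one _)
    (fun σ σ' h => prob_congr fun ρ => by rw [ALc a b σ σ' h])
    (fun σ σ' h => prob_congr fun ρ => by rw [ALc c d σ σ' h])
  rw [eF, eG] at R
  refine le_trans R ?_
  have e1 : ex (fun σ => F σ * G σ) = prob (fun x : Profile n k × (Profile n k × Profile n k) =>
      EE f i a b (AL a b x.1 x.2.1) ∧ EE f j c d (AL c d x.1 x.2.2)) := by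
    rw [prob_prod]
    congr 1
    funext σ
    exact (prob_indep (fun ρ => EE f i a b (AL a b σ ρ)) (fun ρ => EE f j c d (AL c d σ ρ))).symm
  rw [e1]
  have b1 : ∀ σ ρ : Profile n k, AL a b (update σ j (phi c d (σ j))) ρ = AL a b σ ρ := by
    intro σ ρ
    apply ALc
    intro l
    by_cases h : l = j
    · subst h; rw [Function.update_self]; exact phi_bits hda hdb _
    · rw [Function.update_of_ne h]
  have b2 : ∀ σ ρ : Profile n k, AL c d (update σ i (phi a b (σ i))) ρ = AL c d σ ρ := by
    intro σ ρ
    apply ALc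
    intro l
    by_cases h : l = i
    · subst h; rw [Function.update_self]; exact phi_bits hbc hbd _
    · rw [Function.update_of_ne h]
  set W1 : Profile n k × (Profile n k × Profile n k) → Prop := fun x =>
    EE f i a b (update x.1 j (phi c d (x.1 j))) ≠
      EE f i a b (AL a b (update x.1 j (phi c d (x.1 j))) x.2.1) with hW1
  set W2 : Profile n k × (Profile n k × Profile n k) → Prop := fun x =>
    EE f j c d (update x.1 i (phi a b (x.1 i))) ≠
      EE f j c d (AL c d (update x.1 i (phi a b (x.1 i))) x.2.2) with hW2
  have p1 : prob W1 ≤ k * (12 * n * (k : ℝ) ^ 4 * mm f + 2 * (k : ℝ) ^ 3 * t) := by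
    have D1 := ((dom_upd (dom_phi c d) j).prodMap (Ω₂ := Profile n k)).comp (by norm_num)
      ((dom_fst (Ω := Profile n k) (Ω' := Profile n k)).prodMap_right (Ω₂ := Profile n k))
      (fun x => EE f i a b x.1 ≠ EE f i a b (AL a b x.1 x.2))
    rw [one_mul] at D1
    exact le_trans D1 (mul_le_mul_of_nonneg_left (einv_all f hab i t ht0 ht) (by positivity))
  have p2 : prob W2 ≤ k * (12 * n * (k : ℝ) ^ 4 * mm f + 2 * (k : ℝ) ^ 3 * t) := by
    have D1 := ((dom_upd (dom_phi a b) i).prodMap (Ω₂ := Profile n k)).comp (by norm_num)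
      ((dom_snd (Ω := Profile n k) (Ω' := Profile n k)).prodMap_right (Ω₂ := Profile n k))
      (fun x => EE f j c d x.1 ≠ EE f j c d (AL c d x.1 x.2))
    rw [one_mul] at D1
    exact le_trans D1 (mul_le_mul_of_nonneg_left (einv_all f hcd j t ht0 ht') (by positivity))
  have p3 := prob_cross f hij hab hcd hda hdb
  rw [← prob_fst (Ω' := Profile n k × Profile n k)] at p3
  calc _ ≤ prob (fun x => (W1 x ∨ W2 x) ∨ (EE f i a b (update x.1 j (phi c d (x.1 j))) ∧
        EE f j c d (update x.1 i (phi a b (x.1 i))))) := by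
        apply prob_mono
        intro x hx
        by_cases h1 : W1 x
        · exact Or.inl (Or.inl h1)
        by_cases h2 : W2 x
        · exact Or.inl (Or.inr h2)
        right
        simp only [hW1, hW2, ne_eq, not_not, b1, b2] at h1 h2
        rw [h1, h2]
        exact hx
    _ ≤ (prob W1 + prob W2) + _ := le_trans (prob_or _ _) (add_le_add_left (prob_or _ _) _)
    _ ≤ _ := by linarith

/-- Two distinct influences force manipulation or a local dictator. -/
lemma inter (f : Profile n k → Fin k) (hn : 1 ≤ n) (hk : 1 ≤ k) {i j : Fin n} (hij : i ≠ j)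
    {a b c d : Fin k}
    (hab : a ≠ b) (hcd : c ≠ d) (h1 : ¬ (a = c ∧ b = d)) (h2 : ¬ (a = d ∧ b = c)) (δ : ℝ)
    (hδ : 0 ≤ δ) (H1 : δ ≤ prob (EE f i a b)) (H2 : δ ≤ prob (EE f j c d)) (t : ℝ) (ht0 : 0 ≤ t)
    (ht : ∀ l a b e, a ≠ b → e ≠ a → e ≠ b → prob (TT f l a b e) ≤ t) :
    δ ^ 4 ≤ 28 * n * (k : ℝ) ^ 5 * mm f + 4 * (k : ℝ) ^ 4 * t := by
  have main : ∀ a b c d : Fin k, a ≠ b → c ≠ d → d ≠ a → d ≠ b → b ≠ c → δ ≤ prob (EE f i a b) →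
      δ ≤ prob (EE f j c d) → δ ^ 4 ≤ 28 * n * (k : ℝ) ^ 5 * mm f + 4 * (k : ℝ) ^ 4 * t := by
    intro a b c d hab hcd hda hdb hbc H1 H2
    have := inter_aux f hij hab hcd hda hdb hbc t ht0 (fun e h h' => ht i a b e hab h h')
      (fun e h h' => ht j c d e hcd h h')
    have e : δ ^ 4 ≤ prob (EE f i a b) ^ 2 * prob (EE f j c d) ^ 2 := by
      calc δ ^ 4 = δ ^ 2 * δ ^ 2 := by ring
        _ ≤ _ := by gcongr
    have hm := mm_nonneg f
    have hn' : (1 : ℝ) ≤ n := by exact_mod_cast hn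
    have hk' : (1 : ℝ) ≤ k := by exact_mod_cast hk
    have : (k : ℝ) ^ 2 * mm f ≤ n * (k : ℝ) ^ 5 * mm f := by
      gcongr
      calc (k : ℝ) ^ 2 ≤ k ^ 5 := pow_le_pow_right₀ hk' (by norm_num)
        _ ≤ _ := le_mul_of_one_le_left (by positivity) hn'
    nlinarith
  have s1 := prob_EE_symm f i a b
  have s2 := prob_EE_symm f j c d
  by_cases q1 : b = c ∨ b = d
  · by_cases q2 : d = a ∨ d = b
    · refine main b a d c hab.symm hcd.symm ?_ ?_ ?_ (s1 ▸ H1) (s2 ▸ H2) <;> grind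
    · refine main b a c d hab.symm hcd ?_ ?_ ?_ (s1 ▸ H1) H2 <;> grind
  · by_cases q2 : d = a ∨ d = b
    · refine main a b d c hab hcd.symm ?_ ?_ ?_ H1 (s2 ▸ H2) <;> grind
    · refine main a b c d hab hcd ?_ ?_ ?_ H1 H2 <;> grind

end Inter
end QGS

namespace QGS

/-! ## The local dictator case -/

section Dict

variable {n k : ℕ}

open Function (update)

def insEquiv (i : Fin n) : Profile n k × Profile n k ≃ Profile n k × Profile n k where
  toFun x := (update x.1 i (x.2 i), update x.2 i (x.1 i))
  invFun x := (update x.1 i (x.2 i), update x.2 i (x.1 i))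
  left_inv x := by simp
  right_inv x := by simp

lemma dom_ins (i : Fin n) :
    Dom 1 (fun x : Profile n k × Profile n k => update x.1 i (x.2 i)) := by
  have := (dom_fst (Ω := Profile n k) (Ω' := Profile n k)).comp (by norm_num)
    (dom_equiv (insEquiv (k := k) i))
  rw [one_mul] at this
  exact this

lemma dom_insT {C C' : ℝ} (hC : 0 ≤ C) (hC' : 0 ≤ C')
    {T S : Equiv.Perm (Fin k) → Equiv.Perm (Fin k)} (hT : Dom C T) (hS : Dom C' S) (i j : Fin n) :
    Dom (C * C') (fun x : Profile n k × Profile n k =>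
      update (update x.1 j (S (x.1 j))) i (T (x.2 i))) := by
  have h1 := ((dom_upd hS j).prodMap (Ω₂ := Profile n k)).comp hC
    ((dom_upd hT i).prodMap_right (Ω₂ := Profile n k))
  have h2 := (dom_ins i).comp (mul_nonneg hC hC') h1
  rw [mul_one] at h2
  intro p
  have := h2 p
  simpa using this

lemma bad3 (f : Profile n k → Fin k) {i j : Fin n} (hij : i ≠ j) {d e : Fin k} (hde : d ≠ e)
    {C : ℝ} (hC : 0 ≤ C) {T : Equiv.Perm (Fin k) → Equiv.Perm (Fin k)} (hT : Dom C T) :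
    prob (fun x : Profile n k × Profile n k => EE f j d e x.1 ∧ Above (x.1 i) e d ∧
      ¬ EE f j d e (update x.1 i (T (x.2 i))) ∧ Above (T (x.2 i)) e d) ≤
      C * (12 * (k : ℝ) ^ 4 * mm f) := by
  have h1 := ((dom_upd hT i).prodMap_right (Ω₂ := Profile n k)) (fun x : Profile n k × Profile n k =>
    EE f j d e x.1 ≠ EE f j d e (update x.1 i (al d e (x.1 i) (x.2 i))))
  refine le_trans (prob_mono ?_) (le_trans h1
    (mul_le_mul_of_nonneg_left (einv_one f hde j i hij) hC))
  rintro ⟨σ, ρ⟩ ⟨h1, h2, h3, h4⟩ h5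
  simp only [Function.update_self] at h5
  rw [al_def, if_pos] at h5
  · rw [h5] at h1
    exact h3 h1
  · exact iff_of_false (above_asymm h2) (above_asymm h4)

lemma dict (f : Profile n k → Fin k) (hn : 1 ≤ n) (hk : 1 ≤ k) {i j : Fin n} (hij : i ≠ j)
    {a b c d e : Fin k} (hab : a ≠ b) (hac : a ≠ c) (hbc : b ≠ c) (hde : d ≠ e) :
    prob (fun σ => EE f j d e σ ∧ Above (σ i) e d) * prob (TT f i a b c) ≤
      38 * n * (k : ℝ) ^ 7 * mm f := by
  have hm := mm_nonneg f
  obtain ⟨s, hs⟩ : ∃ s, val6 a b c s ≠ d := by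
    by_cases h : a = d
    · refine ⟨5, ?_⟩
      show b ≠ d
      exact fun h' => hab (h.trans h'.symm)
    · exact ⟨0, h⟩
  obtain ⟨T, hT⟩ : ∃ T : Equiv.Perm (Fin k) → Equiv.Perm (Fin k),
    T = fun τ => six a b c s * phi a b (phi a c τ) := ⟨_, rfl⟩
  have dT : Dom ((k : ℝ) ^ 2) T := by
    rw [hT]
    exact dom_lmul_phi2 (six a b c s) a b c
  have dTy : ∀ y, Dom ((k : ℝ) ^ 3) (fun τ => phi y d (T τ)) := by
    intro y
    have := (dom_phi y d).comp (by positivity) dT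
    rwa [← pow_succ] at this
  set Φ : Profile n k → Profile n k := fun σ => update σ j (phi d e (σ j)) with hΦ
  rw [← prob_indep]
  set W1 : Profile n k × Profile n k → Prop := fun x =>
    TT f i a b c x.2 ≠ TT f i a b c (mix {i}ᶜ x.2 (Φ x.1)) with hW1
  set W2 : Profile n k × Profile n k → Prop := fun x =>
    IsManipPointR 4 f (update (Φ x.1) i (T (x.2 i))) with hW2
  set W3 : Profile n k × Profile n k → Prop := fun x => ∃ y ∈ (univ : Finset (Fin k)),
    IsManipPointR 4 f (update (Φ x.1) i (phi y d (T (x.2 i)))) with hW3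
  set W4 : Profile n k × Profile n k → Prop := fun x => EE f j d e x.1 ∧ Above (x.1 i) e d ∧
      ¬ EE f j d e (update x.1 i (T (x.2 i))) ∧ Above (T (x.2 i)) e d with hW4
  set W5 : Profile n k × Profile n k → Prop := fun x => EE f j d e x.1 ∧ Above (x.1 i) e d ∧
      ¬ EE f j d e (update x.1 i (phi e d (T (x.2 i)))) ∧ Above (phi e d (T (x.2 i))) e d with hW5
  have p1 : prob W1 ≤ k * (12 * n * (k : ℝ) ^ 4 * mm f) := by
    have h := (((dom_upd (dom_phi d e) j).prodMap_right (Ω₂ := Profile n k)).comp (by norm_num)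
      (dom_equiv (Equiv.prodComm (Profile n k) (Profile n k))))
      (fun x => TT f i a b c x.1 ≠ TT f i a b c (mix {i}ᶜ x.1 x.2))
    rw [one_mul] at h
    exact le_trans h (mul_le_mul_of_nonneg_left (tinv f hab hac hbc i) (by positivity))
  have p2 : prob W2 ≤ (k : ℝ) ^ 2 * k * mm f :=
    dom_insT (by positivity) (by positivity) dT (dom_phi d e) i j (IsManipPointR 4 f)
  have p3 : prob W3 ≤ k * ((k : ℝ) ^ 3 * k * mm f) := by
    refine le_trans (prob_exists _ _) (le_trans (Finset.sum_le_sum fun y _ =>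
      dom_insT (by positivity) (by positivity) (dTy y) (dom_phi d e) i j (IsManipPointR 4 f)) ?_)
    simp [mm]
  have p4 : prob W4 ≤ (k : ℝ) ^ 2 * (12 * (k : ℝ) ^ 4 * mm f) :=
    bad3 f hij hde (by positivity) dT
  have p5 : prob W5 ≤ (k : ℝ) ^ 3 * (12 * (k : ℝ) ^ 4 * mm f) := by
    have hk3 : (0 : ℝ) ≤ (k : ℝ) ^ 3 := by positivity
    have h5 := bad3 f hij hde hk3 (dTy e)
    exact h5
  have key : ∀ x : Profile n k × Profile n k,
      ((EE f j d e x.1 ∧ Above (x.1 i) e d) ∧ TT f i a b c x.2) →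
      W1 x ∨ W2 x ∨ W3 x ∨ W4 x ∨ W5 x := by
    rintro ⟨σ, ρ⟩ ⟨⟨h1, h2⟩, h3⟩
    by_contra hW
    push Not at hW
    obtain ⟨n1, n2, n3, n4, n5⟩ := hW
    simp only [hW1, hW2, hW3, hW4, hW5, ne_eq, not_not] at n1 n2 n3 n4 n5
    simp only at h1 h2 h3
    rw [n1] at h3
    have h4 := h3 s
    have e1 : mix {i}ᶜ ρ (Φ σ) i = ρ i := by simp [mix]
    have e2 : ∀ τ, update (mix {i}ᶜ ρ (Φ σ)) i τ = update (Φ σ) i τ := by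
      intro τ
      funext l
      by_cases h : l = i
      · subst h; simp
      · simp [h, mix]
    rw [e1, e2] at h4
    have hT' : six a b c s * phi a b (phi a c (ρ i)) = T (ρ i) := by rw [hT]
    rw [hT'] at h4
    have fin : ∀ τ, f (update (Φ σ) i τ) = val6 a b c s → ¬ EE f j d e (update σ i τ) := by
      intro τ h5 h6
      have := h6.1
      rw [Function.update_of_ne hij.symm, Function.update_comm hij] at this
      exact hs (h5.symm.trans this)
    rcases above_or (T (ρ i)) e d with h | h | h
    · exact hde h.symm
    · exact n4 ⟨h1, h2, fin _ h4, h⟩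
    · refine n5 ⟨h1, h2, fin _ ?_, phi_above e d hde.symm _⟩
      exact down_lem n2 (fun y hy => n3 ⟨y, mem_univ _, hy⟩) h4 hs e h
  have hn' : (1 : ℝ) ≤ n := by exact_mod_cast hn
  have hk' : (1 : ℝ) ≤ k := by exact_mod_cast hk
  have pw : ∀ r : ℕ, r ≤ 7 → (k : ℝ) ^ r * mm f ≤ n * (k : ℝ) ^ 7 * mm f := by
    intro r hr
    gcongr
    calc (k : ℝ) ^ r ≤ k ^ 7 := pow_le_pow_right₀ hk' hr
      _ ≤ _ := le_mul_of_one_le_left (by positivity) hn'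
  have pw5 : n * (k : ℝ) ^ 5 * mm f ≤ n * (k : ℝ) ^ 7 * mm f := by
    have := pow_le_pow_right₀ hk' (show 5 ≤ 7 by norm_num)
    gcongr
  have q3 := pw 3 (by norm_num)
  have q5 := pw 5 (by norm_num)
  have q6 := pw 6 (by norm_num)
  have q7 := pw 7 (by norm_num)
  calc _ ≤ prob (fun x => W1 x ∨ W2 x ∨ W3 x ∨ W4 x ∨ W5 x) := prob_mono key
    _ ≤ prob W1 + (prob W2 + (prob W3 + (prob W4 + prob W5))) := by
        refine le_trans (prob_or _ _) (add_le_add_right ?_ _)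
        refine le_trans (prob_or _ _) (add_le_add_right ?_ _)
        refine le_trans (prob_or _ _) (add_le_add_right ?_ _)
        exact prob_or _ _
    _ ≤ k * (12 * n * (k : ℝ) ^ 4 * mm f) + ((k : ℝ) ^ 2 * k * mm f + (k * ((k : ℝ) ^ 3 * k * mm f) +
        ((k : ℝ) ^ 2 * (12 * (k : ℝ) ^ 4 * mm f) + (k : ℝ) ^ 3 * (12 * (k : ℝ) ^ 4 * mm f)))) :=
        add_le_add p1 (add_le_add p2 (add_le_add p3 (add_le_add p4 p5)))
    _ = 12 * (n * (k : ℝ) ^ 5 * mm f) + (k : ℝ) ^ 3 * mm f + (k : ℝ) ^ 5 * mm f +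
        12 * ((k : ℝ) ^ 6 * mm f) + 12 * ((k : ℝ) ^ 7 * mm f) := by ring
    _ ≤ 38 * (n * (k : ℝ) ^ 7 * mm f) := by linarith
    _ = _ := by ring

lemma dict_half (f : Profile n k → Fin k) (hn : 1 ≤ n) (hk : 1 ≤ k) {i j : Fin n} (hij : i ≠ j)
    {a b c d e : Fin k} (hab : a ≠ b) (hac : a ≠ c) (hbc : b ≠ c) (hde : d ≠ e) :
    prob (EE f j d e) * prob (TT f i a b c) ≤ 76 * n * (k : ℝ) ^ 7 * mm f := by
  have h1 := dict f hn hk hij hab hac hbc hde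
  have h2 := dict f hn hk hij hab hac hbc hde.symm
  have h3 : prob (fun σ => EE f j d e σ ∧ Above (σ i) d e) ≤
      prob (fun σ => EE f j e d σ ∧ Above (σ i) d e) := by
    have := dom_swap j d e (fun σ => EE f j e d σ ∧ Above (σ i) d e)
    rw [one_mul] at this
    refine le_trans (le_of_eq (prob_congr fun σ => ?_)) this
    beta_reduce
    rw [Function.update_of_ne hij, EE_symm]
  have h4 : prob (EE f j d e) = prob (fun σ => EE f j d e σ ∧ Above (σ i) d e) +
      prob (fun σ => EE f j d e σ ∧ Above (σ i) e d) := by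
    rw [← prob_split (EE f j d e) (fun σ => Above (σ i) d e)]
    congr 1
    exact prob_congr fun σ => by rw [not_above hde]
  have h5 := mul_le_mul_of_nonneg_right h3 (prob_nonneg (TT f i a b c))
  rw [h4]
  linarith

end Dict
end QGS

namespace QGS

/-! ## Existence of influences -/

section Exist

variable {n k : ℕ}

open Function (update)

lemma step_le (f : Profile n k → Fin k) (l : Fin n) (r : ℕ) {u v : Fin k} (huv : u ≠ v) :
    prob (fun σ => f σ = u ∧ f (mv l r σ) = v) ≤ 2 * mm f + prob (EE f l u v) := by
  have d := dom_mv (k := k) l r (IsManipPointR 4 f)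
  rw [one_mul] at d
  have key : ∀ σ, (f σ = u ∧ f (mv l r σ) = v) →
      (IsManipPointR 4 f σ ∨ IsManipPointR 4 f (mv l r σ)) ∨ EE f l u v σ := by
    rintro σ ⟨h1, h2⟩
    by_contra hM
    push Not at hM
    obtain ⟨⟨m1, m2⟩, hE⟩ := hM
    rcases sw_edge (σ l) r with h | ⟨x, y, h⟩
    · have : mv l r σ = σ := by unfold mv; rw [h, Function.update_eq_self]
      rw [this] at h2
      exact huv (h1.symm.trans h2)
    · have m1' : ¬ IsManipPointR 4 f (update σ l (σ l)) := by rwa [Function.update_eq_self]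
      have q := edge_lem h m1' m2
      rw [Function.update_eq_self, h1] at q
      change u = f (mv l r σ) ∨ (u = x ∧ f (mv l r σ) = y) at q
      rw [h2] at q
      rcases q with q | ⟨q1, q2⟩
      · exact huv q
      · subst q1 q2
        apply hE
        have e := phi_self h.1 h.adj
        unfold EE
        rw [e, ← h.eq_swap, Function.update_eq_self]
        exact ⟨h1, h2⟩
  calc _ ≤ _ := prob_mono key
    _ ≤ _ := prob_or _ _
    _ ≤ (prob (IsManipPointR 4 f) + prob (fun σ => IsManipPointR 4 f (mv l r σ))) + _ :=
        add_le_add_left (prob_or _ _) _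
    _ ≤ _ := by
        have : mm f = prob (IsManipPointR 4 f) := rfl
        linarith

lemma infl {β : Type*} (f : Profile n k → Fin k) (g : Fin k → β) (L : Finset (Fin n)) (δ η : ℝ)
    (hδ : 0 ≤ δ) (hη : η ≤ prob (fun x : Profile n k × Profile n k =>
      g (f x.1) ≠ g (f (mix L x.1 x.2)))) (h : n * (k : ℝ) ^ 4 * (2 * mm f + δ) < η) :
    ∃ l ∈ L, ∃ u v, g u ≠ g v ∧ δ ≤ prob (EE f l u v) := by
  by_contra hc
  push Not at hc
  have hm := mm_nonneg f
  have s1 : ∀ l ∈ L, ∀ r, prob (fun x : Unit × Profile n k => g (f x.2) ≠ g (f (mv l r x.2))) ≤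
      (k : ℝ) ^ 2 * (2 * mm f + δ) := by
    intro l hl r
    rw [prob_snd (fun σ : Profile n k => g (f σ) ≠ g (f (mv l r σ)))]
    calc _ ≤ prob (fun σ : Profile n k => ∃ u ∈ (univ : Finset (Fin k)),
          ∃ v ∈ (univ : Finset (Fin k)), g u ≠ g v ∧ f σ = u ∧ f (mv l r σ) = v) :=
          prob_mono fun σ h => ⟨_, mem_univ _, _, mem_univ _, h, rfl, rfl⟩
      _ ≤ ∑ u : Fin k, ∑ v : Fin k, (2 * mm f + δ) := by
          refine le_trans (prob_exists _ _) (Finset.sum_le_sum fun u _ =>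
            le_trans (prob_exists _ _) (Finset.sum_le_sum fun v _ => ?_))
          by_cases huv : g u = g v
          · rw [prob_false (fun σ h => h.1 huv)]
            linarith
          · refine le_trans (prob_mono (fun σ h => h.2))
              (le_trans (step_le f l r (fun e => huv (congrArg g e))) ?_)
            have := hc l hl u v huv
            linarith
      _ = _ := by
          simp only [Finset.sum_const, Finset.card_univ, Fintype.card_fin, nsmul_eq_mul]
          ring
  have P := poincare (Θ := Unit) (fun _ σ => g (f σ)) L
  have e : prob (fun x : (Unit × Profile n k) × Profile n k =>
      g (f x.1.2) ≠ g (f (mix L x.1.2 x.2))) = prob (fun x : Profile n k × Profile n k =>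
      g (f x.1) ≠ g (f (mix L x.1 x.2))) :=
    prob_equiv ((Equiv.punitProd (Profile n k)).prodCongr (Equiv.refl (Profile n k)))
      (fun x : Profile n k × Profile n k => g (f x.1) ≠ g (f (mix L x.1 x.2)))
  have P2 : prob (fun x : Profile n k × Profile n k =>
      g (f x.1) ≠ g (f (mix L x.1 x.2))) ≤ k * ∑ l ∈ L, ∑ r ∈ Finset.range k,
        (k : ℝ) ^ 2 * (2 * mm f + δ) := by
    rw [← e]
    refine le_trans P (mul_le_mul_of_nonneg_left ?_ (by positivity))
    exact Finset.sum_le_sum fun l hl => Finset.sum_le_sum fun r _ => s1 l hl r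
  have hL : (L.card : ℝ) ≤ n := by
    have := Finset.card_le_univ L
    rw [Fintype.card_fin] at this
    exact_mod_cast this
  simp only [Finset.sum_const, Finset.card_range, nsmul_eq_mul] at P2
  have : (k : ℝ) * (L.card * (k * ((k : ℝ) ^ 2 * (2 * mm f + δ)))) ≤
      n * (k : ℝ) ^ 4 * (2 * mm f + δ) := by
    have : (L.card : ℝ) * ((k : ℝ) ^ 4 * (2 * mm f + δ)) ≤ n * ((k : ℝ) ^ 4 * (2 * mm f + δ)) :=
      mul_le_mul_of_nonneg_right hL (by positivity)
    nlinarith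
  linarith

lemma infl_set (f : Profile n k → Fin k) (A : Finset (Fin k)) (δ p q : ℝ) (hp0 : 0 ≤ p)
    (hq0 : 0 ≤ q)
    (hδ : 0 ≤ δ) (hp : p ≤ prob (fun σ => f σ ∈ A)) (hq : q ≤ prob (fun σ => f σ ∉ A))
    (h : n * (k : ℝ) ^ 4 * (2 * mm f + δ) < p * q) :
    ∃ l, ∃ u v, ¬ (u ∈ A ↔ v ∈ A) ∧ δ ≤ prob (EE f l u v) := by
  obtain ⟨l, _, u, v, h1, h2⟩ := infl f (fun x => x ∈ A) univ δ (p * q) hδ (by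
    calc p * q ≤ prob (fun σ => f σ ∈ A) * prob (fun σ => f σ ∉ A) :=
          mul_le_mul hp hq hq0 (prob_nonneg _)
      _ = prob (fun x : Profile n k × Profile n k => f x.1 ∈ A ∧ f x.2 ∉ A) :=
          (prob_indep (fun σ => f σ ∈ A) (fun σ => f σ ∉ A)).symm
      _ ≤ _ := by
          apply prob_mono
          rintro ⟨σ, ρ⟩ ⟨h1, h2⟩ h3
          have e : mix univ σ ρ = ρ := by funext l; simp [mix]
          simp only [e] at h3
          rw [h3] at h1
          exact h2 h1) h
  exact ⟨l, u, v, fun e => h1 (propext e), h2⟩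

lemma exists_infl (f : Profile n k → Fin k) (hn : 1 ≤ n) (hk : 1 ≤ k) (ε δ : ℝ) (hε : 0 < ε)
    (hδ : 0 ≤ δ) (hsm : n * (k : ℝ) ^ 4 * (2 * mm f + δ) < 1 / k * ε)
    (hD : ∀ g : Profile n k → Fin k, InNonManipBar g →
      ε ≤ prob (fun σ : Profile n k => f σ ≠ g σ)) :
    ∃ i j : Fin n, ∃ a b c d : Fin k, i ≠ j ∧ a ≠ b ∧ c ≠ d ∧ ¬ (a = c ∧ b = d) ∧
      ¬ (a = d ∧ b = c) ∧ δ ≤ prob (EE f i a b) ∧ δ ≤ prob (EE f j c d) := by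
  have hk' : (1 : ℝ) ≤ k := by exact_mod_cast hk
  obtain ⟨a, ha⟩ : ∃ a : Fin k, 1 / (k : ℝ) ≤ prob (fun σ => f σ = a) := by
    by_contra hc
    push Not at hc
    have h1 : prob (fun σ : Profile n k => ∃ a ∈ (univ : Finset (Fin k)), f σ = a) ≤
      ∑ a : Fin k, prob (fun σ => f σ = a) := prob_exists _ _
    have h2 : prob (fun σ : Profile n k => ∃ a ∈ (univ : Finset (Fin k)), f σ = a) = 1 :=
      prob_true fun σ => ⟨_, mem_univ _, rfl⟩
    have h3 : ∑ a : Fin k, prob (fun σ => f σ = a) < ∑ a : Fin k, 1 / (k : ℝ) :=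
      Finset.sum_lt_sum_of_nonempty ⟨⟨0, hk⟩, mem_univ _⟩ fun a _ => hc a
    simp only [Finset.sum_const, Finset.card_univ, Fintype.card_fin, nsmul_eq_mul] at h3
    rw [mul_one_div_cancel (by positivity)] at h3
    linarith
  have two : ∀ u v, u = a ∨ v = a → ∃ l, ∃ c d, ¬ (c ∈ ({u, v} : Finset (Fin k)) ↔ d ∈ ({u, v} : Finset (Fin k))) ∧
      δ ≤ prob (EE f l c d) := by
    intro u v huv
    refine infl_set f {u, v} δ (1 / k) ε (by positivity) hε.le hδ ?_ ?_ hsm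
    · refine le_trans ha (prob_mono fun σ h => ?_)
      rw [h, mem_insert, mem_singleton]
      exact huv.imp Eq.symm Eq.symm
    · have := hD (fun σ => if f σ ∈ ({u, v} : Finset (Fin k)) then f σ else u) (Or.inr ⟨u, v, by
        intro σ
        beta_reduce
        split_ifs with h
        · simpa using h
        · exact Or.inl rfl⟩)
      refine le_trans this (prob_mono fun σ h hh => h ?_)
      rw [if_pos hh]
  obtain ⟨l1, u, v, h1, E1⟩ := two a a (Or.inl rfl)
  simp only [mem_insert, mem_singleton, or_self] at h1
  obtain ⟨l2, c, d, h2, E2⟩ := two u v (by tauto)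
  simp only [mem_insert, mem_singleton] at h2
  by_cases hl : l1 = l2
  · subst hl
    obtain ⟨l3, hl3, x, y, h3, E3⟩ := infl f id {l1}ᶜ δ ε hδ (by
      apply prob_prod_ge_const
      intro ρ
      exact hD (fun σ => f (mix {l1}ᶜ σ ρ)) (Or.inl ⟨l1, by
        intro σ σ' h
        refine congrArg f (funext fun j => ?_)
        by_cases hj : j = l1
        · subst hj; simp [mix, h]
        · simp [mix, hj]⟩)) (lt_of_lt_of_le hsm (by
          have : 1 / (k : ℝ) ≤ 1 := by rw [div_le_one (by positivity)]; exact hk'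
          nlinarith))
    have hl3' : l3 ≠ l1 := by simpa using hl3
    simp only [id] at h3
    by_cases hp : (x = u ∧ y = v) ∨ (x = v ∧ y = u)
    · refine ⟨l3, l1, x, y, c, d, hl3', h3, ?_, ?_, ?_, E3, E2⟩ <;> grind
    · refine ⟨l3, l1, x, y, u, v, hl3', h3, ?_, ?_, ?_, E3, E1⟩ <;> grind
  · refine ⟨l1, l2, u, v, c, d, hl, ?_, ?_, ?_, ?_, E1, E2⟩ <;> grind

lemma final (f : Profile n k → Fin k) (hn : 1 ≤ n) (hk : 1 ≤ k) (ε : ℝ) (hε0 : 0 < ε)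
    (hε1 : ε ≤ 1)
    (hD : ∀ g : Profile n k → Fin k, InNonManipBar g →
      ε ≤ prob (fun σ : Profile n k => f σ ≠ g σ)) :
    ε ^ 5 / (10 ^ 9 * (n : ℝ) ^ 7 * (k : ℝ) ^ 46) ≤ mm f := by
  have hn' : (1 : ℝ) ≤ n := by exact_mod_cast hn
  have hk' : (1 : ℝ) ≤ k := by exact_mod_cast hk
  have hn0 : (0 : ℝ) < n := by linarith
  have hk0 : (0 : ℝ) < k := by linarith
  have fin : ∀ (C : ℝ) (p q r : ℕ), 0 < C → C ≤ 10 ^ 9 → q ≤ 7 → r ≤ 46 → p ≤ 5 →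
      ε ^ p ≤ C * (n : ℝ) ^ q * (k : ℝ) ^ r * mm f →
      ε ^ 5 / (10 ^ 9 * (n : ℝ) ^ 7 * (k : ℝ) ^ 46) ≤ mm f := by
    intro C p q r hC0 hC hq hr hp h
    rw [div_le_iff₀' (by positivity)]
    have hm := mm_nonneg f
    calc ε ^ 5 ≤ ε ^ p := pow_le_pow_of_le_one hε0.le hε1 hp
      _ ≤ _ := h
      _ ≤ _ := by
          have a1 := pow_le_pow_right₀ hn' hq
          have a2 := pow_le_pow_right₀ hk' hr
          gcongr
  obtain ⟨δ, hδ⟩ : ∃ δ : ℝ, δ = ε / (3 * n * k ^ 5) := ⟨_, rfl⟩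
  have hδ0 : 0 < δ := by rw [hδ]; positivity
  have hε : ε = 3 * n * (k : ℝ) ^ 5 * δ := by rw [hδ]; field_simp
  by_cases hm : mm f ≤ δ / 2
  swap
  · refine fin 6 1 1 5 (by norm_num) (by norm_num) (by norm_num) (by norm_num) (by norm_num) ?_
    push Not at hm
    rw [pow_one, pow_one, hε]
    have : (0 : ℝ) < n * (k : ℝ) ^ 5 := by positivity
    nlinarith
  have hsm : n * (k : ℝ) ^ 4 * (2 * mm f + δ) < 1 / k * ε := by
    have e : 1 / (k : ℝ) * ε = n * (k : ℝ) ^ 4 * (3 * δ) := by rw [hε]; field_simp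
    rw [e]
    have : 2 * mm f + δ < 3 * δ := by linarith
    gcongr
  obtain ⟨i, j, a, b, c, d, hij, hab, hcd, h1, h2, E1, E2⟩ :=
    exists_infl f hn hk ε δ hε0 hδ0.le hsm hD
  obtain ⟨t, ht⟩ : ∃ t : ℝ, t = δ ^ 4 / (8 * k ^ 4) := ⟨_, rfl⟩
  have ht0 : 0 < t := by rw [ht]; positivity
  have ht' : δ ^ 4 = 8 * k ^ 4 * t := by rw [ht]; field_simp
  by_cases hT : ∀ l a b e, a ≠ b → e ≠ a → e ≠ b → prob (TT f l a b e) ≤ t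
  · have := inter f hn hk hij hab hcd h1 h2 δ hδ0.le E1 E2 t ht0.le hT
    have h4 : δ ^ 4 ≤ 56 * n * (k : ℝ) ^ 5 * mm f := by linarith
    refine fin (81 * 56) 4 5 25 (by norm_num) (by norm_num) (by norm_num) (by norm_num)
      (by norm_num) ?_
    calc ε ^ 4 = 81 * n ^ 4 * (k : ℝ) ^ 20 * δ ^ 4 := by rw [hε]; ring
      _ ≤ 81 * n ^ 4 * (k : ℝ) ^ 20 * (56 * n * (k : ℝ) ^ 5 * mm f) := by gcongr
      _ = _ := by ring
  · push Not at hT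
    obtain ⟨l, a', b', e', hab', hea, heb, hT⟩ := hT
    have key : δ * t ≤ 76 * n * (k : ℝ) ^ 7 * mm f := by
      by_cases hl : l = i
      · have hlj : l ≠ j := hl ▸ hij
        refine le_trans ?_ (dict_half f hn hk hlj hab' hea.symm heb.symm hcd)
        exact mul_le_mul E2 hT.le ht0.le (prob_nonneg _)
      · refine le_trans ?_ (dict_half f hn hk hl hab' hea.symm heb.symm hab)
        exact mul_le_mul E1 hT.le ht0.le (prob_nonneg _)
    refine fin (243 * 608) 5 6 36 (by norm_num) (by norm_num) (by norm_num) (by norm_num)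
      (by norm_num) ?_
    calc ε ^ 5 = 243 * n ^ 5 * (k : ℝ) ^ 25 * (δ * δ ^ 4) := by rw [hε]; ring
      _ = 243 * 8 * n ^ 5 * (k : ℝ) ^ 29 * (δ * t) := by rw [ht']; ring
      _ ≤ 243 * 8 * n ^ 5 * (k : ℝ) ^ 29 * (76 * n * (k : ℝ) ^ 7 * mm f) := by gcongr
      _ = _ := by ring

end Exist
end QGS

theorem stmt4 (n k : ℕ) (hn : 2 ≤ n) (hk : 3 ≤ k)
    (ε : ℝ) (hε0 : 0 < ε) (hε1 : ε ≤ 1)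
    (f : Profile n k → Fin k)
    (hD : ∀ g : Profile n k → Fin k, InNonManipBar g →
      ε ≤ prob (fun σ : Profile n k => f σ ≠ g σ)) :
    ε ^ 5 / (10 ^ 9 * (n : ℝ) ^ 7 * (k : ℝ) ^ 46) ≤
      prob (fun σ : Profile n k => IsManipPointR 4 f σ) := by
  exact QGS.final f (by omega) (by omega) ε hε0 hε1 hD
end

section
/- Let n ≥ 2, k ≥ 3, 0 < ε ≤ 1, let f : S_k^n → [k] be an SCF, and let a, b, c be three distinct alternatives. If P(σ ∈ Lg(B_1^{a,b})) ≥ ε/(n k^3) and P(σ ∈ Lg(B_2^{a,c})) ≥ ε/(n k^3), then P(σ ∈ M(f)) ≥ ε^3 / (2 n^3 k^9 (k!)^2). -/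
open Finset

/-! ### Two-voter Gibbard–Satterthwaite -/

lemma above_irrefl {k : ℕ} (τ : Equiv.Perm (Fin k)) (x : Fin k) : ¬ Above τ x x := by
  simp [Above]

lemma above_total {k : ℕ} (τ : Equiv.Perm (Fin k)) {x y : Fin k} (h : x ≠ y) :
    Above τ x y ∨ Above τ y x := by
  unfold Above
  exact lt_or_gt_of_ne (fun e => h (τ.symm.injective e))

lemma exists_perm_two {k : ℕ} (x y p q : Fin k) (hxy : x ≠ y) (hpq : p ≠ q) :
    ∃ τ : Equiv.Perm (Fin k), τ.symm x = p ∧ τ.symm y = q := by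
  have hne : Equiv.swap x p y ≠ p := by
    intro h
    have h2 : Equiv.swap x p y = Equiv.swap x p x := by rw [h, Equiv.swap_apply_left]
    exact hxy ((Equiv.swap x p).injective h2).symm
  refine ⟨((Equiv.swap x p).trans (Equiv.swap (Equiv.swap x p y) q)).symm, ?_, ?_⟩
  · simp only [Equiv.symm_symm, Equiv.trans_apply, Equiv.swap_apply_left]
    exact Equiv.swap_apply_of_ne_of_ne hne.symm hpq
  · simp only [Equiv.symm_symm, Equiv.trans_apply, Equiv.swap_apply_left]

/-- `x` is at the top of `τ`. -/
def TopOf {k : ℕ} (τ : Equiv.Perm (Fin k)) (x : Fin k) : Prop := ∀ z, z ≠ x → Above τ x z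

lemma exists_first_second {k : ℕ} (hk : 3 ≤ k) (x y : Fin k) (hxy : x ≠ y) :
    ∃ τ : Equiv.Perm (Fin k), TopOf τ x ∧ ∀ z, z ≠ x → z ≠ y → Above τ y z := by
  obtain ⟨τ, h1, h2⟩ := exists_perm_two x y ⟨0, by omega⟩ ⟨1, by omega⟩ hxy (by simp)
  have hx : ∀ z, z ≠ x → (τ.symm z : ℕ) ≠ 0 := by
    intro z hz h
    apply hz; apply τ.symm.injective; rw [h1]; exact Fin.ext h
  have hy : ∀ z, z ≠ y → (τ.symm z : ℕ) ≠ 1 := by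
    intro z hz h
    apply hz; apply τ.symm.injective; rw [h2]; exact Fin.ext h
  refine ⟨τ, ?_, ?_⟩
  · intro z hz
    have := hx z hz
    unfold Above; rw [h1, Fin.lt_def]; simp only; omega
  · intro z hz hz'
    have := hx z hz
    have := hy z hz'
    unfold Above; rw [h2, Fin.lt_def]; simp only; omega

lemma exists_first_last {k : ℕ} (hk : 3 ≤ k) (x y : Fin k) (hxy : x ≠ y) :
    ∃ τ : Equiv.Perm (Fin k), TopOf τ x ∧ ∀ z, z ≠ y → Above τ z y := by
  obtain ⟨τ, h1, h2⟩ := exists_perm_two x y ⟨0, by omega⟩ ⟨k - 1, by omega⟩ hxy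
    (by simp; omega)
  have hx : ∀ z, z ≠ x → (τ.symm z : ℕ) ≠ 0 := by
    intro z hz h
    apply hz; apply τ.symm.injective; rw [h1]; exact Fin.ext h
  have hy : ∀ z, z ≠ y → (τ.symm z : ℕ) ≠ k - 1 := by
    intro z hz h
    apply hz; apply τ.symm.injective; rw [h2]; exact Fin.ext h
  refine ⟨τ, ?_, ?_⟩
  · intro z hz
    have := hx z hz
    unfold Above; rw [h1, Fin.lt_def]; simp only; omega
  · intro z hz
    have := hy z hz
    have := (τ.symm z).2
    unfold Above; rw [h2, Fin.lt_def]; simp only; omega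

/-- Voter one never gains by misreporting. -/
def SP1 {k : ℕ} (g : Equiv.Perm (Fin k) → Equiv.Perm (Fin k) → Fin k) : Prop :=
  ∀ s s' t, ¬ Above s (g s' t) (g s t)

lemma SP1.top {k : ℕ} {g : Equiv.Perm (Fin k) → Equiv.Perm (Fin k) → Fin k} (h : SP1 g)
    {s s' t : Equiv.Perm (Fin k)} {x : Fin k} (hx : g s t = x) (ht : TopOf s' x) :
    g s' t = x := by
  by_contra hne
  apply h s' s t
  rw [hx]
  exact ht _ hne

lemma SP1.bot {k : ℕ} {g : Equiv.Perm (Fin k) → Equiv.Perm (Fin k) → Fin k} (h : SP1 g)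
    {s s' t : Equiv.Perm (Fin k)} {x : Fin k} (hx : g s t = x)
    (ht : ∀ z, z ≠ x → Above s z x) : g s' t = x := by
  by_contra hne
  apply h s s' t
  rw [hx]
  exact ht _ hne

/-- Key step: excluded third alternatives. -/
lemma no_third {k : ℕ} (hk : 3 ≤ k) {g : Equiv.Perm (Fin k) → Equiv.Perm (Fin k) → Fin k}
    (h1 : SP1 g) (h2 : SP1 (fun t s => g s t)) {x y : Fin k}  (hxy : x ≠ y)
    (hy : ∃ s t, g s t = y) {s t : Equiv.Perm (Fin k)}
    (hs : ∀ z, z ≠ x → z ≠ y → Above s y z) (ht : TopOf t y) : g s t = x ∨ g s t = y := by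
  by_contra! hcon
  obtain ⟨s0, t0, h0⟩ := hy
  obtain ⟨s1, hs1, -⟩ := exists_first_last hk y x hxy.symm
  have e1 : g s1 t0 = y := h1.top h0 hs1
  have e2 : g s1 t = y := h2.top (s := t0) (s' := t) (t := s1) e1 ht
  apply h1 s s1 t
  rw [e2]
  exact hs _ hcon.1 hcon.2

lemma dec_half {k : ℕ} (hk : 3 ≤ k) {g : Equiv.Perm (Fin k) → Equiv.Perm (Fin k) → Fin k}
    (h1 : SP1 g) (h2 : SP1 (fun t s => g s t)) {x y : Fin k}  (hxy : x ≠ y)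
    (hy : ∃ s t, g s t = y) {s t : Equiv.Perm (Fin k)}
    (hs : ∀ z, z ≠ x → z ≠ y → Above s y z) (ht : TopOf t y) (hg : g s t = x) :
    ∀ s t, TopOf s x → g s t = x := by
  intro s2 t2 hs2
  obtain ⟨t', ht', hb⟩ := exists_first_last hk y x hxy.symm
  have e : g s t' = x := by
    rcases no_third hk h1 h2 hxy hy hs ht' with h | h
    · exact h
    · exfalso
      apply h2 t t' s
      simp only [h, hg]
      exact ht x hxy
  have e2 : g s t2 = x := h2.bot (s := t') (s' := t2) (t := s) e hb
  exact h1.top e2 hs2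

lemma dec {k : ℕ} (hk : 3 ≤ k) {g : Equiv.Perm (Fin k) → Equiv.Perm (Fin k) → Fin k}
    (h1 : SP1 g) (h2 : SP1 (fun t s => g s t)) {x y : Fin k}  (hxy : x ≠ y)
    (hx : ∃ s t, g s t = x) (hy : ∃ s t, g s t = y) :
    (∀ s t, TopOf s x → g s t = x) ∨ (∀ s t, TopOf t y → g s t = y) := by
  obtain ⟨s, hs, hs'⟩ := exists_first_second hk x y hxy
  obtain ⟨t, ht, ht'⟩ := exists_first_second hk y x hxy.symm
  rcases no_third hk h1 h2 hxy hy hs' ht with h | h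
  · exact Or.inl (dec_half hk h1 h2 hxy hy hs' ht h)
  · right
    obtain ⟨s0, t0, h0⟩ := hx
    have := dec_half (g := fun t s => g s t) hk h2 h1 hxy.symm ⟨t0, s0, h0⟩ ht' hs h
    exact fun s t hh => this t s hh

lemma dec_contra {k : ℕ} (hk : 3 ≤ k) {g : Equiv.Perm (Fin k) → Equiv.Perm (Fin k) → Fin k}
    {x y : Fin k}  (hxy : x ≠ y)
    (hx : ∀ s t, TopOf s x → g s t = x) (hy : ∀ s t, TopOf t y → g s t = y) : False := by
  obtain ⟨s, hs, -⟩ := exists_first_second hk x y hxy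
  obtain ⟨t, ht, -⟩ := exists_first_second hk y x hxy.symm
  exact hxy ((hx s t hs).symm.trans (hy s t ht))

lemma dec_final {k : ℕ} (hk : 3 ≤ k) {g : Equiv.Perm (Fin k) → Equiv.Perm (Fin k) → Fin k}
    (h1 : SP1 g) {x y : Fin k}  (hxy : x ≠ y)
    (hx : ∀ s t, TopOf s x → g s t = x) (hy : ∀ s t, TopOf s y → g s t = y)
    {s t t' : Equiv.Perm (Fin k)} (e1 : g s t = x) (e2 : g s t' = y) : False := by
  obtain ⟨s1, hs1, -⟩ := exists_first_second hk x y hxy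
  obtain ⟨s2, hs2, -⟩ := exists_first_second hk y x hxy.symm
  rcases above_total s hxy with h | h
  · apply h1 s s1 t'
    rw [e2, hx s1 t' hs1]; exact h
  · apply h1 s s2 t
    rw [e1, hy s2 t hs2]; exact h

/-- Two-voter Gibbard–Satterthwaite. -/
lemma gs_two {k : ℕ} (hk : 3 ≤ k) {g : Equiv.Perm (Fin k) → Equiv.Perm (Fin k) → Fin k}
    (h1 : SP1 g) (h2 : SP1 (fun t s => g s t)) {a b c : Fin k}
    (hab : a ≠ b) (hac : a ≠ c) (hbc : b ≠ c) {s s' t t' : Equiv.Perm (Fin k)}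
    (ha : g s t = a) (hb : g s' t = b) (hc : g s t' = c) : False := by
  rcases dec hk h1 h2 hab ⟨_, _, ha⟩ ⟨_, _, hb⟩ with h | h
  · rcases dec hk h1 h2 hbc.symm ⟨_, _, hc⟩ ⟨_, _, hb⟩ with h' | h'
    · exact dec_final hk h1 hac h h' ha hc
    · exact dec_contra hk hab h h'
  · rcases dec hk h1 h2 hac.symm ⟨_, _, hc⟩ ⟨_, _, ha⟩ with h' | h'
    · exact dec_contra hk hbc.symm h' h
    · exact dec_final (g := fun t s => g s t) hk h2 hab (fun t s => h' s t) (fun t s => h s t)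
        ha hb

/-! ### Reverse hypercontractivity -/

lemma poly_ineq (r x y : ℝ) (hr : 0 ≤ r) (hx : 0 ≤ x) (hy : 0 ≤ y) :
    9 * ((2*r+x)^2 + (2*r+y)^2 - 4*r^2)^3 ≤
      16 * (2*(2*r+x)^3 - 6*r^2*(2*r+x) + (2*r+y)^3 - 3*r^2*(2*r+y))^2 := by
  have h4 : 0 ≤ 2916*x^4 - 288*x^3*y + 1224*x^2*y^2 - 288*x*y^3 + 324*y^4 := by
    nlinarith [sq_nonneg (x*(x-y)), sq_nonneg (y*(x-y)), sq_nonneg (x*x), sq_nonneg (y*y),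
      sq_nonneg (x*y)]
  have h5 : 0 ≤ 660*x^5 - 108*x^4*y + 168*x^3*y^2 + 168*x^2*y^3 - 108*x*y^4 + 84*y^5 := by
    have e1 : 0 ≤ x^3*(x-y)^2 := by positivity
    have e2 : 0 ≤ y^3*(x-y)^2 := by positivity
    have e3 : 0 ≤ x^5 := by positivity
    have e4 : 0 ≤ y^5 := by positivity
    have e5 : 0 ≤ x^3*y^2 := by positivity
    have e6 : 0 ≤ x^2*y^3 := by positivity
    nlinarith
  have h6 : 0 ≤ 55*x^6 - 27*x^4*y^2 + 64*x^3*y^3 - 27*x^2*y^4 + 7*y^6 := by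
    have c1 : 0 ≤ 55*x^3 - 27*x*y^2 + 32*y^3 := by
      nlinarith [mul_nonneg hx (sq_nonneg (x-y)), mul_nonneg hy (sq_nonneg (x-y)),
        pow_nonneg hx 3, pow_nonneg hy 3]
    have c2 : 0 ≤ 32*x^3 - 27*x^2*y + 7*y^3 := by
      nlinarith [mul_nonneg hx (sq_nonneg (x-y)), mul_nonneg hy (sq_nonneg (x-y)),
        pow_nonneg hx 3, pow_nonneg hy 3]
    have := mul_nonneg (pow_nonneg hx 3) c1
    have := mul_nonneg (pow_nonneg hy 3) c2
    nlinarith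
  have l1 : 0 ≤ r^5*(1728*x) + r^4*(5328*x^2+1728*x*y+288*y^2)
      + r^3*(5856*x^3+864*x^2*y+864*x*y^2+480*y^3) := by positivity
  have := mul_nonneg (pow_nonneg hr 2) h4
  have := mul_nonneg hr h5
  nlinarith

lemma two_point_aux (u0 u1 v0 v1 : ℝ) (hu0 : 0 ≤ u0) (hu1 : 0 ≤ u1) (hv0 : 0 ≤ v0)
    (hv1 : 0 ≤ v1) :
    9 * ((u0^2+u1^2)*(v0^2+v1^2))^3 ≤
      16 * (2*(u0*v0)^3 + 2*(u1*v1)^3 + (u0*v1)^3 + (u1*v0)^3)^2 := by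
  set r := Real.sqrt (u0*u1*v0*v1) with hr
  have hr0 : 0 ≤ r := Real.sqrt_nonneg _
  have hr2 : r^2 = u0*u1*v0*v1 := Real.sq_sqrt (by positivity)
  have hX : 2*r ≤ u0*v0 + u1*v1 :=
    (abs_le_of_sq_le_sq' (by nlinarith [sq_nonneg (u0*v0-u1*v1)]) (by positivity)).2
  have hY : 2*r ≤ u0*v1 + u1*v0 :=
    (abs_le_of_sq_le_sq' (by nlinarith [sq_nonneg (u0*v1-u1*v0)]) (by positivity)).2
  have := poly_ineq r (u0*v0+u1*v1-2*r) (u0*v1+u1*v0-2*r) hr0 (by linarith) (by linarith)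
  have a1 : 2*r + (u0*v0+u1*v1-2*r) = u0*v0+u1*v1 := by ring
  have a2 : 2*r + (u0*v1+u1*v0-2*r) = u0*v1+u1*v0 := by ring
  rw [a1, a2, hr2] at this
  convert this using 1 <;> ring

lemma two_point (p0 p1 q0 q1 : ℝ) (hp0 : 0 ≤ p0) (hp1 : 0 ≤ p1) (hq0 : 0 ≤ q0)
    (hq1 : 0 ≤ q1) :
    (Real.sqrt ((p0+p1)/2) * Real.sqrt ((q0+q1)/2))^3 ≤
      (2*(Real.sqrt p0*Real.sqrt q0)^3 + 2*(Real.sqrt p1*Real.sqrt q1)^3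
        + (Real.sqrt p0*Real.sqrt q1)^3 + (Real.sqrt p1*Real.sqrt q0)^3)/6 := by
  have h := two_point_aux (Real.sqrt p0) (Real.sqrt p1) (Real.sqrt q0) (Real.sqrt q1)
    (Real.sqrt_nonneg _) (Real.sqrt_nonneg _) (Real.sqrt_nonneg _) (Real.sqrt_nonneg _)
  rw [Real.sq_sqrt hp0, Real.sq_sqrt hp1, Real.sq_sqrt hq0, Real.sq_sqrt hq1] at h
  refine (abs_le_of_sq_le_sq' ?_ (by positivity)).2
  have e : ((Real.sqrt ((p0+p1)/2) * Real.sqrt ((q0+q1)/2))^3)^2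
      = (((p0+p1)/2) * ((q0+q1)/2))^3 := by
    rw [← pow_mul, mul_comm 3 2, pow_mul, mul_pow, Real.sq_sqrt (by positivity),
      Real.sq_sqrt (by positivity)]
  rw [e]
  nlinarith

lemma sum_cons_eq {T : Type*} [Fintype T] {n : ℕ} (h : (Fin (n+1) → T) → ℝ) :
    ∑ σ, h σ = ∑ τ : T, ∑ σ : Fin n → T, h (Fin.cons τ σ) := by
  rw [← Fintype.sum_prod_type']
  exact (Fintype.sum_equiv (Fin.consEquiv (fun _ : Fin (n+1) => T)) _ _ (fun _ => rfl)).symm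

lemma comp_cons {T : Type*} {n : ℕ} (α : T → Bool) (τ : T) (σ : Fin n → T) :
    (fun i => α ((Fin.cons τ σ : Fin (n+1) → T) i))
      = (Fin.cons (α τ) (fun i => α (σ i)) : Fin (n+1) → Bool) := by
  funext i
  refine Fin.cases ?_ (fun j => ?_) i <;> simp

lemma rhc {T : Type*} [Fintype T] (M : ℝ) (hM : 0 < M) (α β : T → Bool)
    (hT : ∀ φ : Bool → Bool → ℝ, ∑ τ, φ (α τ) (β τ) =
      M * (2 * φ true true + 2 * φ false false + φ true false + φ false true)) :
    ∀ (n : ℕ) (F G : (Fin n → Bool) → ℝ), (∀ z, 0 ≤ F z ∧ F z ≤ 1) →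
      (∀ z, 0 ≤ G z ∧ G z ≤ 1) →
      (Real.sqrt ((∑ σ : Fin n → T, F (fun i => α (σ i))) / (6*M)^n) *
        Real.sqrt ((∑ σ : Fin n → T, G (fun i => β (σ i))) / (6*M)^n))^3 ≤
      (∑ σ : Fin n → T, F (fun i => α (σ i)) * G (fun i => β (σ i))) / (6*M)^n := by
  intro n
  induction n with
  | zero =>
    intro F G hF hG
    have key : ∀ p : ℝ, 0 ≤ p → p ≤ 1 → (Real.sqrt p)^3 ≤ p := by
      intro p h0 h1
      have h2 : Real.sqrt p ≤ 1 := Real.sqrt_le_one.mpr h1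
      have h3 := Real.sq_sqrt h0
      have h4 := Real.sqrt_nonneg p
      nlinarith
    simp only [Fintype.sum_unique, pow_zero, div_one]
    rw [mul_pow]
    exact mul_le_mul (key _ (hF _).1 (hF _).2) (key _ (hG _).1 (hG _).2)
      (by positivity) (hF _).1
  | succ n ih =>
    intro F G hF hG
    have hFs : ∑ σ : Fin (n+1) → T, F (fun i => α (σ i)) = M * (3 *
        (∑ σ : Fin n → T, F (Fin.cons true (fun i => α (σ i)))) + 3 *
        (∑ σ : Fin n → T, F (Fin.cons false (fun i => α (σ i))))) := by
      rw [sum_cons_eq]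
      simp only [comp_cons]
      rw [hT (fun s _ => ∑ σ : Fin n → T, F (Fin.cons s (fun i => α (σ i))))]
      ring
    have hGs : ∑ σ : Fin (n+1) → T, G (fun i => β (σ i)) = M * (3 *
        (∑ σ : Fin n → T, G (Fin.cons true (fun i => β (σ i)))) + 3 *
        (∑ σ : Fin n → T, G (Fin.cons false (fun i => β (σ i))))) := by
      rw [sum_cons_eq]
      simp only [comp_cons]
      rw [hT (fun _ s => ∑ σ : Fin n → T, G (Fin.cons s (fun i => β (σ i))))]
      ring
    have hFG : ∑ σ : Fin (n+1) → T, F (fun i => α (σ i)) * G (fun i => β (σ i)) =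
        M * (2 * (∑ σ : Fin n → T, F (Fin.cons true (fun i => α (σ i))) *
            G (Fin.cons true (fun i => β (σ i)))) +
          2 * (∑ σ : Fin n → T, F (Fin.cons false (fun i => α (σ i))) *
            G (Fin.cons false (fun i => β (σ i)))) +
          (∑ σ : Fin n → T, F (Fin.cons true (fun i => α (σ i))) *
            G (Fin.cons false (fun i => β (σ i)))) +
          (∑ σ : Fin n → T, F (Fin.cons false (fun i => α (σ i))) *
            G (Fin.cons true (fun i => β (σ i))))) := by
      rw [sum_cons_eq]
      simp only [comp_cons]
      exact hT (fun s t => ∑ σ : Fin n → T, F (Fin.cons s (fun i => α (σ i))) *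
        G (Fin.cons t (fun i => β (σ i))))
    rw [hFs, hGs, hFG]
    have ih' := fun s t => ih (fun z => F (Fin.cons s z)) (fun z => G (Fin.cons t z))
      (fun z => hF _) (fun z => hG _)
    have i1 := ih' true true
    have i2 := ih' false false
    have i3 := ih' true false
    have i4 := ih' false true
    have nF : ∀ s, 0 ≤ (∑ σ : Fin n → T, F (Fin.cons s (fun i => α (σ i)))) / (6*M)^n :=
      fun s => div_nonneg (Finset.sum_nonneg (fun _ _ => (hF _).1)) (by positivity)
    have nG : ∀ s, 0 ≤ (∑ σ : Fin n → T, G (Fin.cons s (fun i => β (σ i)))) / (6*M)^n :=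
      fun s => div_nonneg (Finset.sum_nonneg (fun _ _ => (hG _).1)) (by positivity)
    have tp := two_point _ _ _ _ (nF true) (nF false) (nG true) (nG false)
    have e : ∀ A B : ℝ, M * (3 * A + 3 * B) / (6*M)^(n+1)
        = (A / (6*M)^n + B / (6*M)^n) / 2 := by
      intro A B; rw [pow_succ]; field_simp; ring
    rw [e, e]
    refine tp.trans ?_
    have e' : ∀ A B C D : ℝ, M * (2 * A + 2 * B + C + D) / (6*M)^(n+1)
        = (2 * (A / (6*M)^n) + 2 * (B / (6*M)^n) + C / (6*M)^n + D / (6*M)^n) / 6 := by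
      intro A B C D; rw [pow_succ]; field_simp
    rw [e']
    linarith

lemma above_trans {k : ℕ} {τ : Equiv.Perm (Fin k)} {x y z : Fin k} (h : Above τ x y)
    (h' : Above τ y z) : Above τ x z := lt_trans h h'

lemma above_asymm {k : ℕ} {τ : Equiv.Perm (Fin k)} {x y : Fin k} (h : Above τ x y) :
    ¬ Above τ y x := lt_asymm h

open Classical in
lemma sum_relabel {k : ℕ} (φ : Bool → Bool → ℝ) (x y z : Fin k) (π : Equiv.Perm (Fin k)) :
    ∑ τ : Equiv.Perm (Fin k), φ (decide (Above τ (π x) (π y))) (decide (Above τ (π x) (π z)))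
    = ∑ τ : Equiv.Perm (Fin k), φ (decide (Above τ x y)) (decide (Above τ x z)) := by
  refine (Fintype.sum_equiv (Equiv.mulLeft π) _ _ (fun τ => ?_)).symm
  have h : ∀ u v, Above (π * τ) (π u) (π v) ↔ Above τ u v := by
    intro u v
    have : ∀ w, (π * τ).symm (π w) = τ.symm w := by
      intro w; rw [Equiv.symm_apply_eq]; simp
    simp only [Above, this]
  simp only [Equiv.coe_mulLeft, h]

open Classical in
lemma perm_counts {k : ℕ} {a b c : Fin k} (hab : a ≠ b) (hac : a ≠ c) (hbc : b ≠ c)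
    (φ : Bool → Bool → ℝ) :
    ∑ τ : Equiv.Perm (Fin k), φ (decide (Above τ a b)) (decide (Above τ a c))
    = ((Nat.factorial k : ℝ) / 6) *
      (2 * φ true true + 2 * φ false false + φ true false + φ false true) := by
  set S := fun x y z : Fin k =>
    ∑ τ : Equiv.Perm (Fin k), φ (decide (Above τ x y)) (decide (Above τ x z)) with hS
  have r : ∀ (π : Equiv.Perm (Fin k)) (x y z : Fin k), S (π x) (π y) (π z) = S x y z :=
    fun π x y z => sum_relabel φ x y z π
  have s1 : ∀ x y z : Fin k, x ≠ y → x ≠ z → y ≠ z → S y x z = S x y z := by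
    intro x y z h1 h2 h3
    have := r (Equiv.swap x y) x y z
    rwa [Equiv.swap_apply_left, Equiv.swap_apply_right,
      Equiv.swap_apply_of_ne_of_ne h2.symm h3.symm] at this
  have s2 : ∀ x y z : Fin k, x ≠ y → x ≠ z → y ≠ z → S x z y = S x y z := by
    intro x y z h1 h2 h3
    have := r (Equiv.swap y z) x y z
    rwa [Equiv.swap_apply_left, Equiv.swap_apply_right,
      Equiv.swap_apply_of_ne_of_ne h1 h2] at this
  have t1 := s2 a b c hab hac hbc
  have t2 := s1 a b c hab hac hbc
  have t3 := s2 b a c hab.symm hbc hac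
  have t4 := s1 a c b hac hab hbc.symm
  have t5 := s2 c a b hac.symm hbc.symm hab
  have tot : S a b c + S a c b + S b a c + S b c a + S c a b + S c b a
      = (Nat.factorial k : ℝ) *
      (2 * φ true true + 2 * φ false false + φ true false + φ false true) := by
    simp only [hS, ← Finset.sum_add_distrib]
    have : ∀ τ ∈ (Finset.univ : Finset (Equiv.Perm (Fin k))),
        φ (decide (Above τ a b)) (decide (Above τ a c)) +
        φ (decide (Above τ a c)) (decide (Above τ a b)) +
        φ (decide (Above τ b a)) (decide (Above τ b c)) +
        φ (decide (Above τ b c)) (decide (Above τ b a)) +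
        φ (decide (Above τ c a)) (decide (Above τ c b)) +
        φ (decide (Above τ c b)) (decide (Above τ c a)) = 
        (2 * φ true true + 2 * φ false false + φ true false + φ false true) := by
      intro τ _
      have u1 := above_total τ hab
      have u2 := above_total τ hac
      have u3 := above_total τ hbc
      rcases u1 with u1 | u1 <;> rcases u2 with u2 | u2 <;> rcases u3 with u3 | u3 <;>
      first
      | exact absurd (above_trans (above_trans u1 u3) u2) (above_irrefl _ _)
      | exact absurd (above_trans (above_trans u2 u3) u1) (above_irrefl _ _)
      | (simp only [u1, u2, u3, above_asymm u1, above_asymm u2, above_asymm u3,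
          decide_true, decide_false]; ring)
    rw [Finset.sum_congr rfl this]
    simp [Fintype.card_perm]
    ring
  change S a b c = _
  linarith

/-! ### Assembling -/

open Classical in
lemma prob_eq {Ω : Type*} [Fintype Ω] (p : Ω → Prop) :
    prob p = ((Finset.univ.filter p).card : ℝ) / (Fintype.card Ω : ℝ) := rfl

open Classical in
/-- The preference vector. -/
noncomputable def prefVec {n k : ℕ} (a b : Fin k) (σ : Profile n k) : Fin n → Bool :=
  fun i => decide (Above (σ i) a b)

lemma inFiber_iff {n k : ℕ} (a b : Fin k) (z : Fin n → Bool) (σ : Profile n k) :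
    InFiber a b z σ ↔ prefVec a b σ = z := by
  classical
  constructor
  · intro h
    funext i
    rw [Bool.eq_iff_iff]
    simpa [prefVec] using h i
  · rintro rfl i
    simp [prefVec]

open Classical in
lemma bad_bound {n k : ℕ} (f : Profile n k → Fin k) (ε : ℝ) (i : Fin n) (a b : Fin k)
    (η : ℝ) (hη : η = ε ^ 3 / (4 * (n : ℝ) ^ 3 * (k : ℝ) ^ 9)) (hη0 : 0 ≤ η) :
    ((Finset.univ.filter (fun σ : Profile n k =>
      IsLargeFiber f ε i a b (prefVec a b σ) ∧ ¬ OnBoundaryB f i a b σ)).card : ℝ) ≤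
      η * (Fintype.card (Profile n k) : ℝ) := by
  have c1 := Finset.card_eq_sum_card_fiberwise (f := prefVec a b)
    (s := Finset.univ.filter (fun σ : Profile n k =>
      IsLargeFiber f ε i a b (prefVec a b σ) ∧ ¬ OnBoundaryB f i a b σ))
    (t := Finset.univ) (by intro x _; simp)
  have c2 := Finset.card_eq_sum_card_fiberwise (f := prefVec a b)
    (s := (Finset.univ : Finset (Profile n k)))
    (t := Finset.univ) (by intro x _; simp)
  rw [c1, ← Finset.card_univ, c2]
  push_cast
  rw [Finset.mul_sum]
  refine Finset.sum_le_sum (fun z _ => ?_)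
  by_cases hz : IsLargeFiber f ε i a b z
  · have hN : (0:ℝ) < (Fintype.card (Profile n k) : ℝ) := by
      exact_mod_cast Fintype.card_pos
    have hz' := hz
    unfold IsLargeFiber at hz'
    rw [← hη, prob_eq, prob_eq, div_div_div_cancel_right₀ hN.ne'] at hz'
    simp only [InBFiber, inFiber_iff] at hz'
    have split := Finset.card_filter_add_card_filter_not
      (s := Finset.univ.filter (fun σ : Profile n k => prefVec a b σ = z))
      (fun σ : Profile n k => OnBoundaryB f i a b σ)
    rw [Finset.filter_filter, Finset.filter_filter] at split
    have e : (Finset.filter (fun σ => prefVec a b σ = z) (Finset.univ.filter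
        (fun σ : Profile n k => IsLargeFiber f ε i a b (prefVec a b σ) ∧
          ¬ OnBoundaryB f i a b σ))) = Finset.univ.filter
        (fun σ : Profile n k => prefVec a b σ = z ∧ ¬ OnBoundaryB f i a b σ) := by
      ext σ
      simp only [Finset.mem_filter, Finset.mem_univ, true_and]
      constructor
      · rintro ⟨⟨_, h⟩, h'⟩; exact ⟨h', h⟩
      · rintro ⟨rfl, h⟩; exact ⟨⟨hz, h⟩, rfl⟩
    rw [e]
    have split' : ((Finset.univ.filter (fun σ : Profile n k => prefVec a b σ = z ∧
        OnBoundaryB f i a b σ)).card : ℝ) + ((Finset.univ.filter (fun σ : Profile n k =>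
        prefVec a b σ = z ∧ ¬ OnBoundaryB f i a b σ)).card : ℝ) =
        ((Finset.univ.filter (fun σ : Profile n k => prefVec a b σ = z)).card : ℝ) := by
      exact_mod_cast split
    rcases (Nat.cast_nonneg (α := ℝ) (Finset.univ.filter
      (fun σ : Profile n k => prefVec a b σ = z)).card).eq_or_lt with h0 | h0
    · have n1 := Nat.cast_nonneg (α := ℝ) (Finset.univ.filter (fun σ : Profile n k =>
        prefVec a b σ = z ∧ OnBoundaryB f i a b σ)).card
      rw [← h0] at split' ⊢
      linarith
    · rw [le_div_iff₀ h0] at hz'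
      linarith
  · have e : (Finset.filter (fun σ => prefVec a b σ = z) (Finset.univ.filter
        (fun σ : Profile n k => IsLargeFiber f ε i a b (prefVec a b σ) ∧
          ¬ OnBoundaryB f i a b σ))) = ∅ := by
      ext σ
      simp only [Finset.mem_filter, Finset.mem_univ, true_and, Finset.notMem_empty, iff_false]
      rintro ⟨⟨h, _⟩, rfl⟩
      exact hz h
    rw [e]
    simp only [Finset.card_empty, Nat.cast_zero]
    positivity

lemma exists_manip {n k : ℕ} (hk : 3 ≤ k) (f : Profile n k → Fin k) {a b c : Fin k}
    (hab : a ≠ b) (hac : a ≠ c) (hbc : b ≠ c) {i j : Fin n} (hij : i ≠ j)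
    {σ : Profile n k} (h1 : OnBoundaryB f i a b σ) (h2 : OnBoundaryB f j a c σ) :
    ∃ s t, IsManipPoint f (Function.update (Function.update σ i s) j t) := by
  by_contra! hcon
  obtain ⟨ha, σ1, -, hd1, hb⟩ := h1
  obtain ⟨-, σ2, -, hd2, hc⟩ := h2
  set g := fun s t => f (Function.update (Function.update σ i s) j t) with hg
  have sp1 : SP1 g := by
    intro s s' t hA
    refine hcon s t ⟨Function.update (Function.update σ i s') j t, i, ?_, ?_, ?_⟩
    · rw [Function.update_of_ne hij, Function.update_of_ne hij, Function.update_self,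
        Function.update_self]
      rintro rfl
      exact above_irrefl _ _ hA
    · intro l hl
      by_cases h : l = j
      · subst h; simp
      · simp [Function.update_of_ne h, Function.update_of_ne hl]
    · rw [Function.update_of_ne hij, Function.update_self]
      exact hA
  have sp2 : SP1 (fun t s => g s t) := by
    intro t t' s hA
    refine hcon s t ⟨Function.update (Function.update σ i s) j t', j, ?_, ?_, ?_⟩
    · rw [Function.update_self, Function.update_self]
      rintro rfl
      exact above_irrefl _ _ hA
    · intro l hl
      simp [Function.update_of_ne hl]
    · rw [Function.update_self]
      exact hA
  have e0 : g (σ i) (σ j) = a := by simp [hg, ha]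
  have e1 : g (σ1 i) (σ j) = b := by
    rw [← hb]; simp only [hg]; congr 1
    funext l
    by_cases h : l = j
    · subst h; simp [hd1 l hij.symm]
    · rw [Function.update_of_ne h]
      by_cases h' : l = i
      · subst h'; simp
      · rw [Function.update_of_ne h', hd1 l h']
  have e2 : g (σ i) (σ2 j) = c := by
    rw [← hc]; simp only [hg, Function.update_eq_self]; congr 1
    funext l
    by_cases h : l = j
    · subst h; simp
    · rw [Function.update_of_ne h, hd2 l h]
  exact gs_two hk sp1 sp2 hab hac hbc e0 e1 e2

open Classical in
lemma good_card {n k : ℕ} (hk : 3 ≤ k) (f : Profile n k → Fin k) {a b c : Fin k}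
    (hab : a ≠ b) (hac : a ≠ c) (hbc : b ≠ c) {i j : Fin n} (hij : i ≠ j) :
    (Finset.univ.filter (fun σ : Profile n k =>
      OnBoundaryB f i a b σ ∧ OnBoundaryB f j a c σ)).card ≤
    (Finset.univ.filter (fun σ : Profile n k => IsManipPoint f σ)).card *
      (Nat.factorial k) ^ 2 := by
  set M := Finset.univ.filter (fun σ : Profile n k => IsManipPoint f σ)
  have sub : Finset.univ.filter (fun σ : Profile n k =>
      OnBoundaryB f i a b σ ∧ OnBoundaryB f j a c σ) ⊆
      (M ×ˢ ((Finset.univ : Finset (Equiv.Perm (Fin k))) ×ˢ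
        (Finset.univ : Finset (Equiv.Perm (Fin k))))).image
        (fun q => Function.update (Function.update q.1 i q.2.1) j q.2.2) := by
    intro σ hσ
    simp only [Finset.mem_filter, Finset.mem_univ, true_and] at hσ
    obtain ⟨s, t, hm⟩ := exists_manip hk f hab hac hbc hij hσ.1 hσ.2
    rw [Finset.mem_image]
    refine ⟨(Function.update (Function.update σ i s) j t, σ i, σ j), ?_, ?_⟩
    · simp [M, hm]
    · funext l
      by_cases h : l = j
      · subst h; simp
      · by_cases h' : l = i
        · subst h'; simp [Function.update_of_ne h]
        · simp [Function.update_of_ne h, Function.update_of_ne h']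
  refine (Finset.card_le_card sub).trans (Finset.card_image_le.trans ?_)
  rw [Finset.card_product, Finset.card_product, Finset.card_univ, Fintype.card_perm,
    Fintype.card_fin, sq]

open Classical in
lemma inLg_le {n k : ℕ} (f : Profile n k → Fin k) (ε : ℝ) (i : Fin n) (a b : Fin k) :
    prob (fun σ : Profile n k => InLg f ε i a b σ) ≤
      (∑ σ : Profile n k, (if IsLargeFiber f ε i a b (prefVec a b σ) then (1:ℝ) else 0)) /
        (Fintype.card (Profile n k) : ℝ) := by
  rw [prob_eq, Finset.sum_boole]
  gcongr with σ hσ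
  rintro ⟨z, hz, hF, -⟩
  rw [inFiber_iff] at hF
  rw [hF]; exact hz

theorem stmt5 (n k : ℕ) (hn : 2 ≤ n) (hk : 3 ≤ k)
    (ε : ℝ) (hε0 : 0 < ε) (hε1 : ε ≤ 1)
    (f : Profile n k → Fin k) (a b c : Fin k)
    (hab : a ≠ b) (hac : a ≠ c) (hbc : b ≠ c)
    (h1 : ε / ((n : ℝ) * (k : ℝ) ^ 3) ≤
      prob (fun σ : Profile n k => InLg f ε ⟨0, by omega⟩ a b σ))
    (h2 : ε / ((n : ℝ) * (k : ℝ) ^ 3) ≤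
      prob (fun σ : Profile n k => InLg f ε ⟨1, by omega⟩ a c σ)) :
    ε ^ 3 / (2 * (n : ℝ) ^ 3 * (k : ℝ) ^ 9 * (Nat.factorial k : ℝ) ^ 2) ≤
      prob (fun σ : Profile n k => IsManipPoint f σ) := by
  classical
  have hn0 : (0:ℝ) < n := by exact_mod_cast (by omega : 0 < n)
  have hk0 : (0:ℝ) < k := by exact_mod_cast (by omega : 0 < k)
  have hfac : (0:ℝ) < (Nat.factorial k : ℝ) := by exact_mod_cast Nat.factorial_pos k
  have hN : (0:ℝ) < (Fintype.card (Profile n k) : ℝ) := by exact_mod_cast Fintype.card_pos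
  have hcard : (Fintype.card (Profile n k) : ℝ) = (6 * ((Nat.factorial k : ℝ) / 6)) ^ n := by
    rw [mul_div_cancel₀ _ (by norm_num)]
    simp [Fintype.card_perm]
  set i : Fin n := ⟨0, by omega⟩ with hi
  set j : Fin n := ⟨1, by omega⟩ with hj
  have hij : i ≠ j := by simp [hi, hj]
  set δ := ε / ((n : ℝ) * (k : ℝ) ^ 3) with hδ
  have hδ0 : 0 < δ := by positivity
  have hη : δ ^ 3 / 4 = ε ^ 3 / (4 * (n : ℝ) ^ 3 * (k : ℝ) ^ 9) := by
    rw [hδ]; field_simp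
  have b1 := bad_bound f ε i a b (δ ^ 3 / 4) hη (by positivity)
  have b2 := bad_bound f ε j a c (δ ^ 3 / 4) hη (by positivity)
  have p1 := h1.trans (inLg_le f ε i a b)
  have p2 := h2.trans (inLg_le f ε j a c)
  have R := rhc ((Nat.factorial k : ℝ) / 6) (by positivity)
    (fun τ : Equiv.Perm (Fin k) => decide (Above τ a b))
    (fun τ : Equiv.Perm (Fin k) => decide (Above τ a c))
    (perm_counts hab hac hbc) n
    (fun z => if IsLargeFiber f ε i a b z then (1:ℝ) else 0)
    (fun z => if IsLargeFiber f ε j a c z then (1:ℝ) else 0)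
    (fun z => by split_ifs <;> norm_num) (fun z => by split_ifs <;> norm_num)
  rw [← hcard] at R
  have both : δ ^ 3 ≤ ((Finset.univ.filter (fun σ : Profile n k =>
      IsLargeFiber f ε i a b (prefVec a b σ) ∧ IsLargeFiber f ε j a c (prefVec a c σ))).card : ℝ)
      / (Fintype.card (Profile n k) : ℝ) := by
    have s1 := Real.sqrt_le_sqrt p1
    have s2 := Real.sqrt_le_sqrt p2
    have hmul := mul_le_mul s1 s2 (Real.sqrt_nonneg _) (Real.sqrt_nonneg _)
    rw [Real.mul_self_sqrt hδ0.le] at hmul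
    refine (pow_le_pow_left₀ hδ0.le hmul 3).trans (R.trans (le_of_eq ?_))
    congr 1
    rw [← Finset.sum_boole]
    refine Finset.sum_congr rfl (fun σ _ => ?_)
    rw [ite_and, ← ite_and, ite_zero_mul_ite_zero, one_mul]
    rfl
  rw [le_div_iff₀ hN] at both
  have cover : (Finset.univ.filter (fun σ : Profile n k =>
      IsLargeFiber f ε i a b (prefVec a b σ) ∧ IsLargeFiber f ε j a c (prefVec a c σ))) ⊆
      (Finset.univ.filter (fun σ : Profile n k =>
        OnBoundaryB f i a b σ ∧ OnBoundaryB f j a c σ)) ∪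
      ((Finset.univ.filter (fun σ : Profile n k =>
        IsLargeFiber f ε i a b (prefVec a b σ) ∧ ¬ OnBoundaryB f i a b σ)) ∪
      (Finset.univ.filter (fun σ : Profile n k =>
        IsLargeFiber f ε j a c (prefVec a c σ) ∧ ¬ OnBoundaryB f j a c σ))) := by
    intro σ
    simp only [Finset.mem_union, Finset.mem_filter, Finset.mem_univ, true_and]
    tauto
  have cc := (Finset.card_le_card cover).trans ((Finset.card_union_le _ _).trans
    (Nat.add_le_add_left (Finset.card_union_le _ _) _))
  have cc' := (Nat.cast_le (α := ℝ)).mpr cc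
  push_cast at cc'
  have gc := (Nat.cast_le (α := ℝ)).mpr (good_card hk f hab hac hbc hij)
  push_cast at gc
  rw [prob_eq, le_div_iff₀ hN]
  have e : ε ^ 3 / (2 * (n : ℝ) ^ 3 * (k : ℝ) ^ 9 * (Nat.factorial k : ℝ) ^ 2)
      = (δ ^ 3 / 2) / (Nat.factorial k : ℝ) ^ 2 := by
    rw [hδ]; field_simp
  rw [e, div_mul_eq_mul_div, div_le_iff₀ (by positivity)]
  linarith
end
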